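/- Assume the Irrationality Hypothesis. Let A ⊊ B and A ⊆ C be in K_α with A ≤_s B, A ≤_i C, and |C| < m. Then the probability of the following event tends to 1 as n → ∞: for every embedding f of C into G_n such that f(C) = cl^m_{G_n}(f(A)), there is an embedding ĝ of B into G_n extending the restriction of f to A such that ĝ(B) ∩ f(C) = f(A), the sets f(C) and ĝ(B) are freely joined over f(A) in G_n, and cl^m_{G_n}(ĝ(B)) = ĝ(B) ∪ f(C). -/

import Mathlib

open FirstOrder Filter Topology
open scoped Classical

/-- The finite relational language with relation symbols `R i` of arity `k i`, for `i : Fin p`. -/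
def Lang (p : ℕ) (k : Fin p → ℕ) : FirstOrder.Language where
  Functions := fun _ => Empty
  Relations := fun n => { i : Fin p // k i = n }

variable {p : ℕ}

section StructureDefs

/-- The relation `R i` holds on the finite set `C` (set-version of the relation). -/
def HoldsOn (k : Fin p → ℕ) {M : Type*} [(Lang p k).Structure M]
    (i : Fin p) (C : Finset M) : Prop :=
  ∃ v : Fin (k i) → M, Function.Injective v ∧ Finset.image v Finset.univ = C ∧
    Language.Structure.RelMap (L := Lang p k) (⟨i, rfl⟩ : (Lang p k).Relations (k i)) v

/-- `w i A` : the number of `k i`-element subsets of `A` on which `R i` holds. -/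
noncomputable def w (k : Fin p → ℕ) {M : Type*} [(Lang p k).Structure M]
    (i : Fin p) (A : Finset M) : ℕ :=
  Set.ncard {C : Finset M | C ⊆ A ∧ C.card = k i ∧ HoldsOn k i C}

/-- `e(A) = Σ_i α_i · w_i(A)`. -/
noncomputable def eVal (k : Fin p → ℕ) (α : Fin p → ℝ) {M : Type*} [(Lang p k).Structure M]
    (A : Finset M) : ℝ :=
  ∑ i : Fin p, α i * (w k i A : ℝ)

/-- `δ(A) = |A| − e(A)`. -/
noncomputable def delta (k : Fin p → ℕ) (α : Fin p → ℝ) {M : Type*} [(Lang p k).Structure M]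
    (A : Finset M) : ℝ :=
  (A.card : ℝ) - eVal k α A

/-- A structure is symmetric and irreflexive: relations hold only on tuples of pairwise
distinct elements and are invariant under permutations of the tuple. -/
def SymmIrr (k : Fin p → ℕ) (M : Type*) [(Lang p k).Structure M] : Prop :=
  (∀ (n : ℕ) (r : (Lang p k).Relations n) (v : Fin n → M),
      Language.Structure.RelMap r v → Function.Injective v) ∧
  (∀ (n : ℕ) (r : (Lang p k).Relations n) (v : Fin n → M) (σ : Equiv.Perm (Fin n)),
      Language.Structure.RelMap r v → Language.Structure.RelMap r (v ∘ σ))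

/-- Membership in the class `K`: a symmetric irreflexive structure all of whose finite
substructures have (hereditarily) nonnegative `δ`. -/
def InK (k : Fin p → ℕ) (α : Fin p → ℝ) (M : Type*) [(Lang p k).Structure M] : Prop :=
  SymmIrr k M ∧ ∀ A : Finset M, 0 ≤ delta k α A

/-- A finite structure is in `K_α` if it is symmetric irreflexive and `δ(A) ≥ 0` for every
substructure. -/
def InKalpha (k : Fin p → ℕ) (α : Fin p → ℝ) (B : Type*) [(Lang p k).Structure B] : Prop :=
  SymmIrr k B ∧ ∀ S : Finset B, 0 ≤ delta k α S

/-- `d_B(X) = inf { δ(Y) : X ⊆ Y ⊆ B }` (relative version, inside the finite set `B`). -/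
noncomputable def dRel (k : Fin p → ℕ) (α : Fin p → ℝ) {M : Type*} [(Lang p k).Structure M]
    (B X : Finset M) : ℝ :=
  sInf {r : ℝ | ∃ Y : Finset M, X ⊆ Y ∧ Y ⊆ B ∧ r = delta k α Y}

/-- `A ≤_s B` for finite sets: `A ⊆ B` and `d_A(X) = d_B(X)` for all `X ⊆ A`. -/
def StrongIn (k : Fin p → ℕ) (α : Fin p → ℝ) {M : Type*} [(Lang p k).Structure M]
    (A B : Finset M) : Prop :=
  A ⊆ B ∧ ∀ X : Finset M, X ⊆ A → dRel k α A X = dRel k α B X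

/-- `A ≤_i B` (intrinsic extension): there is no `A'` with `A ⊆ A' ⊊ B` and `A' ≤_s B`. -/
def IntrinsicIn (k : Fin p → ℕ) (α : Fin p → ℝ) {M : Type*} [(Lang p k).Structure M]
    (A B : Finset M) : Prop :=
  A ⊆ B ∧ ∀ A' : Finset M, A ⊆ A' → A' ⊂ B → ¬ StrongIn k α A' B

/-- `cl^m_M(A)`: the union of all `B ⊆ M` with `A ≤_i B` and `|B − A| < m`. -/
def cl (k : Fin p → ℕ) (α : Fin p → ℝ) {M : Type*} [(Lang p k).Structure M]
    (m : ℕ) (A : Finset M) : Set M :=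
  {x : M | ∃ B : Finset M, IntrinsicIn k α A B ∧ (B \ A).card < m ∧ x ∈ B}

/-- `C` and `B'` are freely joined over `A` (inside the ambient structure): they intersect in
`A` and every relation on a subset of `C ∪ B'` lives entirely inside `C` or inside `B'`. -/
def FreelyJoined (k : Fin p → ℕ) {M : Type*} [(Lang p k).Structure M]
    (A C B' : Set M) : Prop :=
  C ∩ B' = A ∧
    ∀ (i : Fin p) (S : Finset M), ↑S ⊆ C ∪ B' → HoldsOn k i S → (↑S ⊆ C ∨ ↑S ⊆ B')

/-- `g` is an embedding (of relational structures). -/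
def IsEmb (k : Fin p → ℕ) {M N : Type*} [(Lang p k).Structure M] [(Lang p k).Structure N]
    (g : M → N) : Prop :=
  Function.Injective g ∧
    ∀ (n : ℕ) (r : (Lang p k).Relations n) (v : Fin n → M),
      (Language.Structure.RelMap r (g ∘ v) ↔ Language.Structure.RelMap r v)

/-- `g` restricted to `A` is an embedding of the substructure on `A`. -/
def IsEmbOn (k : Fin p → ℕ) {M N : Type*} [(Lang p k).Structure M] [(Lang p k).Structure N]
    (A : Finset M) (g : M → N) : Prop :=
  Set.InjOn g ↑A ∧
    ∀ (n : ℕ) (r : (Lang p k).Relations n) (v : Fin n → M), (∀ j, v j ∈ A) →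
      (Language.Structure.RelMap r (g ∘ v) ↔ Language.Structure.RelMap r v)

/-- `h` restricts to an isomorphism from the induced structure on `S` onto `S'`. -/
def IsIsoOn (k : Fin p → ℕ) {M N : Type*} [(Lang p k).Structure M] [(Lang p k).Structure N]
    (S : Set M) (S' : Set N) (h : M → N) : Prop :=
  Set.InjOn h S ∧ h '' S = S' ∧
    ∀ (n : ℕ) (r : (Lang p k).Relations n) (v : Fin n → M), (∀ j, v j ∈ S) →
      (Language.Structure.RelMap r (h ∘ v) ↔ Language.Structure.RelMap r v)

/-- A countable structure `M ∈ K` is `(K_α, ≤_s)`-semigeneric if for every `A ≤_s B` with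
`B ∈ K_α` finite and every embedding `g` of `A` into `M`, and each `m`, there is an embedding
`ĝ` of `B` into `M` extending `g` whose image adds nothing to the `m`-closure of `gA` and is
freely joined with `cl^m(gA)` over `gA`. -/
def Semigeneric (k : Fin p → ℕ) (α : Fin p → ℝ) (M : Type*) [(Lang p k).Structure M] : Prop :=
  Countable M ∧ InK k α M ∧
    ∀ (B : Type) (_ : Fintype B) (_ : (Lang p k).Structure B), InKalpha k α B →
      ∀ A : Finset B, StrongIn k α A Finset.univ →
        ∀ g : B → M, IsEmbOn k A g → ∀ m : ℕ,
          ∃ g' : B → M, IsEmb k g' ∧ (∀ a ∈ A, g' a = g a) ∧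
            cl k α m (Finset.image g' Finset.univ) =
              ↑(Finset.image g' Finset.univ) ∪ cl k α m (Finset.image g A) ∧
            FreelyJoined k (↑(Finset.image g A) : Set M) (cl k α m (Finset.image g A))
              (↑(Finset.image g' Finset.univ))

end StructureDefs

section FormulaDefs

/-- A formula is existential if it is an existential quantifier prefix applied to a
quantifier-free formula. -/
def IsExistential (k : Fin p → ℕ) {r : ℕ} (φ : (Lang p k).Formula (Fin r)) : Prop :=
  ∃ (m : ℕ) (ψ : (Lang p k).BoundedFormula (Fin r) m), ψ.IsQF ∧ φ = ψ.exs

/-- Boolean combinations of existential formulas. -/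
inductive IsBoolCombExistential (k : Fin p → ℕ) {r : ℕ} :
    (Lang p k).Formula (Fin r) → Prop
  | of_existential (φ) : IsExistential k φ → IsBoolCombExistential k φ
  | not (φ) : IsBoolCombExistential k φ → IsBoolCombExistential k φ.not
  | inf (φ ψ) : IsBoolCombExistential k φ → IsBoolCombExistential k ψ →
      IsBoolCombExistential k (φ ⊓ ψ)

end FormulaDefs

section Probability

/-- A configuration of potential relations on `{1,…,n}`: for each relation symbol, a Boolean
choice on each finite subset. -/
abbrev Config (p n : ℕ) := (i : Fin p) → Finset (Fin n) → Bool

/-- The valid configurations: `R i` may only hold on sets of size `k i`. -/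
noncomputable def validE (k : Fin p → ℕ) (n : ℕ) : Finset (Config p n) :=
  Finset.univ.filter (fun E => ∀ (i : Fin p) (C : Finset (Fin n)), E i C = true → C.card = k i)

/-- The probability of the configuration `E`: independently for each `i` and each
`k i`-element set `C`, the relation `R i` holds on `C` with probability `γ i · n^{-α i}`. -/
noncomputable def weight (k : Fin p → ℕ) (α γ : Fin p → ℝ) (n : ℕ) (E : Config p n) : ℝ :=
  ∏ i : Fin p, ∏ C ∈ Finset.univ.filter (fun C : Finset (Fin n) => C.card = k i),
    (if E i C = true then γ i * (n : ℝ) ^ (-(α i)) else 1 - γ i * (n : ℝ) ^ (-(α i)))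

/-- The probability `P_n` of an event (a set of configurations). -/
noncomputable def Pev (k : Fin p → ℕ) (α γ : Fin p → ℝ) (n : ℕ)
    (Q : Config p n → Prop) : ℝ :=
  ∑ E ∈ validE k n, if Q E then weight k α γ n E else 0

/-- The random `L⁺`-structure `G_n` on `Fin n` determined by the configuration `E`. -/
def structOf (k : Fin p → ℕ) (n : ℕ) (E : Config p n) : (Lang p k).Structure (Fin n) where
  funMap := fun {_} f _ => f.elim
  RelMap := fun {_} r v => Function.Injective v ∧ E r.1 (Finset.image v Finset.univ) = true

/-- The probability that `G_n ⊨ φ`. -/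
noncomputable def Pn (k : Fin p → ℕ) (α γ : Fin p → ℝ) (n : ℕ)
    (φ : (Lang p k).Sentence) : ℝ :=
  Pev k α γ n (fun E => letI := structOf k n E; (Fin n) ⊨ φ)

/-- The Irrationality Hypothesis: `α_0, …, α_{p−1}, 1` are linearly independent over `ℚ`. -/
def IrrHyp (α : Fin p → ℝ) : Prop :=
  LinearIndependent ℚ (Fin.snoc α (1 : ℝ) : Fin (p + 1) → ℝ)

/-- The almost sure theory `T^α`: the sentences with limit probability 1. -/
noncomputable def Talpha (k : Fin p → ℕ) (α γ : Fin p → ℝ) : (Lang p k).Theory :=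
  {φ : (Lang p k).Sentence | Tendsto (fun n => Pn k α γ n φ) atTop (𝓝 1)}

/-- Auxiliary: `M`, equipped with the structure `S`, satisfies the sentence `φ`. -/
def RealizeS (k : Fin p → ℕ) (M : Type*) (S : (Lang p k).Structure M)
    (φ : (Lang p k).Sentence) : Prop :=
  letI := S; M ⊨ φ

/-- Auxiliary: `M`, equipped with the structure `S`, is a model of the theory `T`. -/
def ModelsT (k : Fin p → ℕ) (M : Type*) (S : (Lang p k).Structure M)
    (T : (Lang p k).Theory) : Prop :=
  ∀ φ ∈ T, RealizeS k M S φ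

end Probability

section RandomSubset

variable {I : Type*} [Fintype I]

/-- Expectation of `F` over the random subset of `I` containing each `c` independently with
probability `pr c`. -/
noncomputable def expect (pr : I → ℝ) (F : Finset I → ℝ) : ℝ :=
  ∑ T : Finset I, (∏ c, if c ∈ T then pr c else 1 - pr c) * F T

lemma expect_mono {pr : I → ℝ} (h : ∀ c, 0 ≤ pr c ∧ pr c ≤ 1) {F G : Finset I → ℝ}
    (hFG : ∀ T, F T ≤ G T) : expect pr F ≤ expect pr G := by
  refine Finset.sum_le_sum fun T _ => mul_le_mul_of_nonneg_left (hFG T) ?_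
  refine Finset.prod_nonneg fun c _ => ?_
  have := h c
  split_ifs <;> linarith

lemma expect_sum {κ : Type*} (pr : I → ℝ) (s : Finset κ) (F : κ → Finset I → ℝ) :
    expect pr (fun T => ∑ a ∈ s, F a T) = ∑ a ∈ s, expect pr (F a) := by
  simp only [expect, Finset.mul_sum]
  exact Finset.sum_comm

lemma expect_add (pr : I → ℝ) (F G : Finset I → ℝ) :
    expect pr (fun T => F T + G T) = expect pr F + expect pr G := by
  simp only [expect, mul_add, Finset.sum_add_distrib]

lemma expect_const_mul (pr : I → ℝ) (a : ℝ) (F : Finset I → ℝ) :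
    expect pr (fun T => a * F T) = a * expect pr F := by
  simp only [expect, Finset.mul_sum]
  exact Finset.sum_congr rfl fun T _ => by ring

lemma expect_subset (pr : I → ℝ) (S : Finset I) [inst : ∀ T, Decidable (S ⊆ T)] :
    expect pr (fun T => if S ⊆ T then 1 else 0) = ∏ c ∈ S, pr c := by
  have h := Finset.prod_add pr (fun c => if c ∈ S then 0 else 1 - pr c) Finset.univ
  have h1 : ∏ c, (pr c + (if c ∈ S then 0 else 1 - pr c)) = ∏ c ∈ S, pr c := by
    rw [← Finset.prod_subset (Finset.subset_univ S)]
    · exact Finset.prod_congr rfl fun c hc => by simp [hc]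
    · intro c _ hc
      simp [hc]
  rw [← h1, h, expect, Finset.powerset_univ]
  refine Finset.sum_congr rfl fun T _ => ?_
  by_cases hS : S ⊆ T
  · rw [if_pos hS, mul_one, ← Finset.prod_mul_prod_compl T, Finset.compl_eq_univ_sdiff]
    congr 1
    · exact Finset.prod_congr rfl fun c hc => by simp [hc]
    · refine Finset.prod_congr rfl fun c hc => ?_
      have hcT : c ∉ T := by simpa using hc
      rw [if_neg hcT, if_neg fun hc' => hcT (hS hc')]
  · rw [if_neg hS, mul_zero]
    obtain ⟨c, hcS, hcT⟩ := Finset.not_subset.1 hS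
    rw [Finset.prod_eq_zero (i := c) (s := Finset.univ \ T) (by simp [hcT]) (by simp [hcS]),
      mul_zero]

lemma expect_one (pr : I → ℝ) : expect pr (fun _ => 1) = 1 := by
  simpa using expect_subset pr ∅

/-- Products of linear combinations of inclusion indicators supported on disjoint blocks have
multiplicative expectation. -/
lemma expect_prod_of_disjoint {J X : Type*} [Fintype J] [Fintype X] (pr : I → ℝ)
    (a : J → X → ℝ) (S : J → X → Finset I)
    (hd : ∀ j j' x x', j ≠ j' → Disjoint (S j x) (S j' x')) :
    expect pr (fun T => ∏ j, ∑ x, a j x * (if S j x ⊆ T then 1 else 0)) =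
      ∏ j, expect pr (fun T => ∑ x, a j x * (if S j x ⊆ T then 1 else 0)) := by
  simp only [expect_sum, expect_const_mul, expect_subset, Finset.prod_univ_sum,
    Finset.prod_mul_distrib]
  refine Finset.sum_congr rfl fun x _ => ?_
  congr 1
  have h1 : ∀ T : Finset I, (∏ j, (if S j (x j) ⊆ T then (1 : ℝ) else 0)) =
      if Finset.univ.biUnion (fun j => S j (x j)) ⊆ T then 1 else 0 := by
    intro T
    rw [Finset.prod_ite_zero]
    simp
  simp only [h1, expect_subset]
  exact Finset.prod_biUnion fun j _ j' _ hj => hd j j' _ _ hj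

end RandomSubset

section SecondMoment

variable {I : Type*} [Fintype I] {β Q K : Type*} [Fintype β] [Fintype Q] [Fintype K]

omit [Fintype I] in
lemma subset_indicator_mul (S S' T : Finset I) :
    (if S ⊆ T then (1 : ℝ) else 0) * (if S' ⊆ T then 1 else 0) = if S ∪ S' ⊆ T then 1 else 0 := by
  by_cases h : S ⊆ T <;> by_cases h' : S' ⊆ T <;> simp [h, h', Finset.union_subset_iff]

lemma card_pow_mul_card_agree (D : Finset β) (x : β → Q) :
    Fintype.card Q ^ D.card * (Finset.univ.filter fun x' : β → Q => ∀ b ∈ D, x b = x' b).card =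
      Fintype.card Q ^ Fintype.card β := by
  have h1 : (Finset.univ.filter fun x' : β → Q => ∀ b ∈ D, x b = x' b) =
      Fintype.piFinset fun b => if b ∈ D then {x b} else Finset.univ := by
    ext x'
    simp only [Finset.mem_filter, Finset.mem_univ, true_and, Fintype.mem_piFinset]
    refine forall_congr' fun b => ?_
    by_cases hb : b ∈ D <;> simp [hb, eq_comm]
  have h2 : ∀ b, (if b ∈ D then ({x b} : Finset Q) else Finset.univ).card =
      if b ∈ D then 1 else Fintype.card Q := by
    intro b
    split_ifs <;> simp
  have h3 : Fintype.card Q ^ D.card = ∏ b, if b ∈ D then Fintype.card Q else 1 := by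
    simp
  rw [h1, Fintype.card_piFinset, h3, ← Finset.prod_mul_distrib]
  simp only [h2]
  rw [Finset.prod_congr rfl (g := fun _ => Fintype.card Q)]
  · simp
  · intro b _
    split_ifs <;> simp

omit [Fintype I] in
lemma prod_union_image_le (pr : I → ℝ) (e : (β → Q) → K → I) (supp : K → Finset β)
    (hsupp : ∀ c, (supp c).Nonempty)
    (he : ∀ x x' c c', e x c = e x' c' ↔ c = c' ∧ ∀ b ∈ supp c, x b = x' b)
    (ρ : K → ℝ) (hρ : ∀ c, 0 < ρ c) (hpe : ∀ x c, pr (e x c) = ρ c) (Λ : ℝ) (hΛ : 0 < Λ)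
    (hD : ∀ D : Finset β, D.Nonempty →
      Λ ≤ (Fintype.card Q : ℝ) ^ D.card * ∏ c with supp c ⊆ D, ρ c) (x x' : β → Q) :
    ∏ c ∈ Finset.univ.image (e x) ∪ Finset.univ.image (e x'), pr c ≤
      (∏ c, ρ c) ^ 2 * (1 + Λ⁻¹ * ∑ D : Finset β, (Fintype.card Q : ℝ) ^ D.card *
        (if ∀ b ∈ D, x b = x' b then 1 else 0)) := by
  have hinj : ∀ x, Function.Injective (e x) := fun x c c' h => ((he x x c c').1 h).1
  have hprod : ∀ x, ∏ c ∈ Finset.univ.image (e x), pr c = ∏ c, ρ c := by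
    intro x
    rw [Finset.prod_image fun c _ c' _ h => hinj x h]
    exact Finset.prod_congr rfl fun c _ => hpe x c
  set ag : Finset β := Finset.univ.filter fun b => x b = x' b with hag
  have hinter : Finset.univ.image (e x) ∩ Finset.univ.image (e x') =
      (Finset.univ.filter fun c => supp c ⊆ ag).image (e x) := by
    ext i
    simp only [Finset.mem_inter, Finset.mem_image, Finset.mem_univ, true_and, Finset.mem_filter]
    constructor
    · rintro ⟨⟨c, rfl⟩, c', hc'⟩
      have := (he x x' c c').1 hc'.symm
      exact ⟨c, fun b hb => by simp [hag, this.2 b hb], rfl⟩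
    · rintro ⟨c, hc, rfl⟩
      refine ⟨⟨c, rfl⟩, c, ((he x x' c c).2 ⟨rfl, fun b hb => ?_⟩).symm⟩
      simpa [hag] using hc hb
  have hR : (∏ c ∈ Finset.univ.image (e x) ∪ Finset.univ.image (e x'), pr c) *
      (∏ c with supp c ⊆ ag, ρ c) = (∏ c, ρ c) ^ 2 := by
    have := Finset.prod_union_inter (s₁ := Finset.univ.image (e x))
      (s₂ := Finset.univ.image (e x')) (f := pr)
    rw [hinter, hprod, hprod, Finset.prod_image fun c _ c' _ h => hinj x h] at this
    rw [sq, ← this]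
    simp only [hpe]
  have hRpos : 0 < ∏ c with supp c ⊆ ag, ρ c := Finset.prod_pos fun c _ => hρ c
  have hπ : 0 ≤ (∏ c, ρ c) ^ 2 := sq_nonneg _
  have hnn : ∀ D : Finset β, 0 ≤ (Fintype.card Q : ℝ) ^ D.card *
        (if ∀ b ∈ D, x b = x' b then 1 else 0) := fun D => by positivity
  rw [eq_div_of_mul_eq hRpos.ne' hR, div_eq_mul_inv]
  refine mul_le_mul_of_nonneg_left ?_ hπ
  by_cases hne : ag.Nonempty
  · have h1 := hD ag hne
    have h2 : (Fintype.card Q : ℝ) ^ ag.card ≤ ∑ D : Finset β, (Fintype.card Q : ℝ) ^ D.card *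
        (if ∀ b ∈ D, x b = x' b then 1 else 0) := by
      have := Finset.single_le_sum (fun D _ => hnn D) (Finset.mem_univ ag)
      rwa [if_pos (by simp [hag]), mul_one] at this
    have h3 : (∏ c with supp c ⊆ ag, ρ c)⁻¹ ≤ Λ⁻¹ * (Fintype.card Q : ℝ) ^ ag.card := by
      rw [inv_mul_eq_div, le_div_iff₀ hΛ, inv_mul_le_iff₀ hRpos, mul_comm]
      exact h1
    have h4 := mul_le_mul_of_nonneg_left h2 (inv_pos.2 hΛ).le
    linarith
  · rw [Finset.not_nonempty_iff_eq_empty] at hne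
    have : (Finset.univ.filter fun c => supp c ⊆ ag) = ∅ := by
      refine Finset.filter_false_of_mem fun c _ hc => ?_
      rw [hne, Finset.subset_empty] at hc
      exact (hsupp c).ne_empty hc
    rw [this, Finset.prod_empty, inv_one]
    have := mul_nonneg (inv_pos.2 hΛ).le (Finset.sum_nonneg fun D (_ : D ∈ Finset.univ) => hnn D)
    linarith

lemma expect_sq_deviation_le (pr : I → ℝ)
    (e : (β → Q) → K → I) (supp : K → Finset β) (hsupp : ∀ c, (supp c).Nonempty)
    (he : ∀ x x' c c', e x c = e x' c' ↔ c = c' ∧ ∀ b ∈ supp c, x b = x' b)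
    (ρ : K → ℝ) (hρ : ∀ c, 0 < ρ c) (hpe : ∀ x c, pr (e x c) = ρ c) (Λ : ℝ) (hΛ : 0 < Λ)
    (hD : ∀ D : Finset β, D.Nonempty →
      Λ ≤ (Fintype.card Q : ℝ) ^ D.card * ∏ c with supp c ⊆ D, ρ c)
    (μ : ℝ) (hμ : μ = (Fintype.card Q : ℝ) ^ Fintype.card β * ∏ c, ρ c) :
    expect pr (fun T => ((∑ x, if Finset.univ.image (e x) ⊆ T then (1 : ℝ) else 0) - μ) ^ 2) ≤
      μ ^ 2 * (2 ^ Fintype.card β / Λ) := by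
  have hprod : ∀ x, ∏ c ∈ Finset.univ.image (e x), pr c = ∏ c, ρ c := by
    intro x
    rw [Finset.prod_image fun c _ c' _ h => ((he x x c c').1 h).1]
    exact Finset.prod_congr rfl fun c _ => hpe x c
  have hexp : ∀ T : Finset I,
      ((∑ x, if Finset.univ.image (e x) ⊆ T then (1 : ℝ) else 0) - μ) ^ 2 =
      (∑ x, ∑ x', if Finset.univ.image (e x) ∪ Finset.univ.image (e x') ⊆ T then (1 : ℝ) else 0)
        + ((-2 * μ) * (∑ x, if Finset.univ.image (e x) ⊆ T then (1 : ℝ) else 0) +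
          μ ^ 2 * 1) := by
    intro T
    rw [sub_sq, sq (∑ x, _), Finset.sum_mul_sum]
    simp only [subset_indicator_mul]
    ring
  simp only [hexp, expect_add, expect_const_mul, expect_sum, expect_subset, hprod, expect_one]
  have hcard : (Fintype.card (β → Q) : ℝ) = (Fintype.card Q : ℝ) ^ Fintype.card β := by
    simp
  have hEY : ∑ _x : β → Q, ∏ c, ρ c = μ := by
    rw [Finset.sum_const, Finset.card_univ, nsmul_eq_mul, hcard, hμ]
  have hag : ∀ (D : Finset β) (x : β → Q),
      ∑ x' : β → Q, (Fintype.card Q : ℝ) ^ D.card * (if ∀ b ∈ D, x b = x' b then 1 else 0) =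
        (Fintype.card Q : ℝ) ^ Fintype.card β := by
    intro D x
    rw [← Finset.mul_sum, Finset.sum_boole]
    exact_mod_cast card_pow_mul_card_agree D x
  have hmain := Finset.sum_le_sum fun x (_ : x ∈ (Finset.univ : Finset (β → Q))) =>
    Finset.sum_le_sum fun x' (_ : x' ∈ (Finset.univ : Finset (β → Q))) =>
      prod_union_image_le pr e supp hsupp he ρ hρ hpe Λ hΛ hD x x'
  have hrhs : ∑ x : β → Q, ∑ x' : β → Q,
      (∏ c, ρ c) ^ 2 * (1 + Λ⁻¹ * ∑ D : Finset β, (Fintype.card Q : ℝ) ^ D.card *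
        (if ∀ b ∈ D, x b = x' b then 1 else 0)) = μ ^ 2 * (1 + 2 ^ Fintype.card β / Λ) := by
    simp only [← Finset.mul_sum, Finset.sum_add_distrib, Finset.sum_const, Finset.card_univ,
      nsmul_eq_mul, mul_one]
    have : ∑ x : β → Q, ∑ x' : β → Q, ∑ D : Finset β, (Fintype.card Q : ℝ) ^ D.card *
        (if ∀ b ∈ D, x b = x' b then (1 : ℝ) else 0) =
        ∑ x : β → Q, ∑ D : Finset β, (Fintype.card Q : ℝ) ^ Fintype.card β := by
      refine Finset.sum_congr rfl fun x _ => ?_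
      rw [Finset.sum_comm]
      exact Finset.sum_congr rfl fun D _ => hag D x
    rw [this]
    simp only [Finset.sum_const, Finset.card_univ, nsmul_eq_mul, hcard, hμ, Fintype.card_finset]
    push_cast
    ring
  rw [hrhs] at hmain
  rw [hEY]
  linarith

/-- If many disjoint families of copies are all underpopulated, this has small probability. -/
lemma expect_all_below_half_le {J : Type*} [Fintype J] (pr : I → ℝ)
    (hpr : ∀ c, 0 ≤ pr c ∧ pr c ≤ 1)
    (e : J → (β → Q) → K → I) (supp : K → Finset β) (hsupp : ∀ c, (supp c).Nonempty)
    (he : ∀ j j' x x' c c', e j x c = e j' x' c' ↔ j = j' ∧ c = c' ∧ ∀ b ∈ supp c, x b = x' b)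
    (ρ : K → ℝ) (hρ : ∀ c, 0 < ρ c) (hpe : ∀ j x c, pr (e j x c) = ρ c) (Λ : ℝ) (hΛ : 0 < Λ)
    (hQ : 0 < Fintype.card Q)
    (hD : ∀ D : Finset β, D.Nonempty →
      Λ ≤ (Fintype.card Q : ℝ) ^ D.card * ∏ c with supp c ⊆ D, ρ c)
    (μ : ℝ) (hμ : μ = (Fintype.card Q : ℝ) ^ Fintype.card β * ∏ c, ρ c) :
    expect pr (fun T => if ∀ j, (∑ x, if Finset.univ.image (e j x) ⊆ T then (1 : ℝ) else 0) < μ / 2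
      then 1 else 0) ≤ (4 * 2 ^ Fintype.card β / Λ) ^ Fintype.card J := by
  have hμpos : 0 < μ := by
    rw [hμ]
    have : (0 : ℝ) < Fintype.card Q := by exact_mod_cast hQ
    exact mul_pos (pow_pos this _) (Finset.prod_pos fun c _ => hρ c)
  set Y : J → Finset I → ℝ :=
    fun j T => ∑ x, if Finset.univ.image (e j x) ⊆ T then (1 : ℝ) else 0 with hY
  have hmarkov : ∀ T : Finset I, (if ∀ j, Y j T < μ / 2 then (1 : ℝ) else 0) ≤
      ∏ j, 4 / μ ^ 2 * (Y j T - μ) ^ 2 := by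
    intro T
    split_ifs with h
    · have h1 : ∀ j ∈ (Finset.univ : Finset J), (1 : ℝ) ≤ 4 / μ ^ 2 * (Y j T - μ) ^ 2 := by
        intro j _
        rw [div_mul_eq_mul_div, le_div_iff₀ (by positivity)]
        nlinarith [h j]
      calc (1 : ℝ) = ∏ _j : J, 1 := by simp
        _ ≤ _ := Finset.prod_le_prod (fun _ _ => zero_le_one) h1
    · exact Finset.prod_nonneg fun j _ => by positivity
  refine (expect_mono hpr hmarkov).trans ?_
  have hpoly : ∀ j T, 4 / μ ^ 2 * (Y j T - μ) ^ 2 =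
      ∑ o : Option (β → Q) × Option (β → Q),
        (4 / μ ^ 2 * (o.1.elim (-μ) fun _ => 1) * (o.2.elim (-μ) fun _ => 1)) *
        (if (o.1.elim ∅ fun x => Finset.univ.image (e j x)) ∪
          (o.2.elim ∅ fun x => Finset.univ.image (e j x)) ⊆ T then 1 else 0) := by
    intro j T
    have h1 : Y j T - μ = ∑ o : Option (β → Q), (o.elim (-μ) fun _ => 1) *
        (if (o.elim ∅ fun x => Finset.univ.image (e j x)) ⊆ T then 1 else 0) := by
      simp only [Fintype.sum_option, hY, Option.elim, Finset.empty_subset, if_true, one_mul, mul_one]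
      exact sub_eq_neg_add _ _
    rw [sq (Y j T - μ), h1, Finset.sum_mul_sum, Finset.mul_sum, Fintype.sum_prod_type]
    refine Finset.sum_congr rfl fun o _ => ?_
    rw [Finset.mul_sum]
    refine Finset.sum_congr rfl fun o' _ => ?_
    rw [← subset_indicator_mul]
    ring
  have hdisj : ∀ (j j' : J) (o o' : Option (β → Q) × Option (β → Q)), j ≠ j' →
      Disjoint ((o.1.elim ∅ fun x => Finset.univ.image (e j x)) ∪
          (o.2.elim ∅ fun x => Finset.univ.image (e j x)))
        ((o'.1.elim ∅ fun x => Finset.univ.image (e j' x)) ∪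
          (o'.2.elim ∅ fun x => Finset.univ.image (e j' x))) := by
    intro j j' o o' hj
    have h1 : ∀ x x' : β → Q,
        Disjoint (Finset.univ.image (e j x)) (Finset.univ.image (e j' x')) := by
      intro x x'
      rw [Finset.disjoint_left]
      intro i hi hi'
      simp only [Finset.mem_image, Finset.mem_univ, true_and] at hi hi'
      obtain ⟨c, rfl⟩ := hi
      obtain ⟨c', hc'⟩ := hi'
      exact hj ((he _ _ _ _ _ _).1 hc').1.symm
    have h2 : ∀ o o' : Option (β → Q),
        Disjoint (o.elim ∅ fun x => Finset.univ.image (e j x))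
          (o'.elim ∅ fun x => Finset.univ.image (e j' x)) := by
      intro o o'
      cases o <;> cases o' <;> simp [h1]
    simp only [Finset.disjoint_union_left, Finset.disjoint_union_right, h2, and_self]
  simp only [hpoly]
  rw [expect_prod_of_disjoint pr _ _ hdisj]
  simp only [← hpoly, expect_const_mul]
  have hj : ∀ j, 4 / μ ^ 2 * expect pr (fun T => (Y j T - μ) ^ 2) ≤
      4 * 2 ^ Fintype.card β / Λ := by
    intro j
    have h1 := expect_sq_deviation_le pr (e j) supp hsupp
      (fun x x' c c' => by simp [he]) ρ hρ (hpe j) Λ hΛ hD μ hμ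
    calc 4 / μ ^ 2 * expect pr (fun T => (Y j T - μ) ^ 2)
        ≤ 4 / μ ^ 2 * (μ ^ 2 * (2 ^ Fintype.card β / Λ)) :=
          mul_le_mul_of_nonneg_left h1 (by positivity)
      _ = _ := by field_simp
  have hnn : ∀ j, 0 ≤ 4 / μ ^ 2 * expect pr (fun T => (Y j T - μ) ^ 2) := by
    intro j
    have h0 : expect pr (fun _ => (0 : ℝ)) = 0 := by simp [expect]
    have := expect_mono hpr (F := fun _ => 0) fun T => sq_nonneg (Y j T - μ)
    rw [h0] at this
    positivity
  calc ∏ j, 4 / μ ^ 2 * expect pr (fun T => (Y j T - μ) ^ 2)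
      ≤ ∏ _j : J, 4 * 2 ^ Fintype.card β / Λ :=
        Finset.prod_le_prod (fun j _ => hnn j) fun j _ => hj j
    _ = _ := by rw [Finset.prod_const, Finset.card_univ]

end SecondMoment

section Predimension

variable {V : Type*}

/-- Total weight of the edges of `E` inside `X`. -/
noncomputable def edgeWeight (α : Fin p → ℝ) (E : Finset (Fin p × Finset V)) (X : Finset V) : ℝ :=
  ∑ c ∈ E with c.2 ⊆ X, α c.1

/-- The predimension of `X` in the hypergraph with edge set `E`. -/
noncomputable def predim (α : Fin p → ℝ) (E : Finset (Fin p × Finset V)) (X : Finset V) : ℝ :=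
  (X.card : ℝ) - edgeWeight α E X

lemma edgeWeight_add_le (α : Fin p → ℝ) (hα : ∀ i, 0 ≤ α i) (E : Finset (Fin p × Finset V))
    (X Y : Finset V) :
    edgeWeight α E X + edgeWeight α E Y ≤ edgeWeight α E (X ∪ Y) + edgeWeight α E (X ∩ Y) := by
  simp only [edgeWeight, Finset.sum_filter, ← Finset.sum_add_distrib]
  refine Finset.sum_le_sum fun c _ => ?_
  have hc := hα c.1
  have h1 : c.2 ⊆ X → c.2 ⊆ X ∪ Y := fun h => h.trans Finset.subset_union_left
  have h2 : c.2 ⊆ Y → c.2 ⊆ X ∪ Y := fun h => h.trans Finset.subset_union_right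
  have h3 : c.2 ⊆ X → c.2 ⊆ Y → c.2 ⊆ X ∩ Y := fun h h' => Finset.subset_inter h h'
  by_cases hX : c.2 ⊆ X <;> by_cases hY : c.2 ⊆ Y
  · simp [hX, hY, h1 hX, h3 hX hY]
  · simp only [hX, hY, h1 hX, if_true, if_false]
    split_ifs <;> linarith
  · simp only [hX, hY, h2 hY, if_true, if_false]
    split_ifs <;> linarith
  · simp only [hX, hY, if_false]
    split_ifs <;> linarith

lemma card_union_add_card_inter_real (X Y : Finset V) :
    ((X ∪ Y).card : ℝ) + ((X ∩ Y).card : ℝ) = X.card + Y.card := by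
  exact_mod_cast Finset.card_union_add_card_inter X Y

lemma predim_submodular (α : Fin p → ℝ) (hα : ∀ i, 0 ≤ α i) (E : Finset (Fin p × Finset V))
    (X Y : Finset V) :
    predim α E (X ∪ Y) + predim α E (X ∩ Y) ≤ predim α E X + predim α E Y := by
  have h1 := edgeWeight_add_le α hα E X Y
  have h2 := card_union_add_card_inter_real X Y
  simp only [predim]
  linarith

/-- The predimension is additive on freely joined sets. -/
lemma predim_add_le_of_free (α : Fin p → ℝ) (E : Finset (Fin p × Finset V))
    (X Y : Finset V) (h : ∀ c ∈ E, c.2 ⊆ X ∪ Y → c.2 ⊆ X ∨ c.2 ⊆ Y) :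
    predim α E X + predim α E Y ≤ predim α E (X ∪ Y) + predim α E (X ∩ Y) := by
  have h2 := card_union_add_card_inter_real X Y
  have h1 : edgeWeight α E (X ∪ Y) + edgeWeight α E (X ∩ Y) ≤
      edgeWeight α E X + edgeWeight α E Y := by
    simp only [edgeWeight, Finset.sum_filter, ← Finset.sum_add_distrib]
    refine Finset.sum_le_sum fun c hc => le_of_eq ?_
    by_cases hX : c.2 ⊆ X <;> by_cases hY : c.2 ⊆ Y
    · simp [hX, hY, hX.trans Finset.subset_union_left, Finset.subset_inter hX hY]
    · have : ¬ c.2 ⊆ X ∩ Y := fun h' => hY (h'.trans Finset.inter_subset_right)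
      simp [hX, hY, hX.trans Finset.subset_union_left, this]
    · have : ¬ c.2 ⊆ X ∩ Y := fun h' => hX (h'.trans Finset.inter_subset_left)
      simp [hX, hY, hY.trans Finset.subset_union_right, this]
    · have h3 : ¬ c.2 ⊆ X ∩ Y := fun h' => hX (h'.trans Finset.inter_subset_left)
      have h4 : ¬ c.2 ⊆ X ∪ Y := fun h' => (h c hc h').elim hX hY
      simp [hX, hY, h3, h4]
  simp only [predim]
  linarith

lemma edgeWeight_sub (α : Fin p → ℝ) (E : Finset (Fin p × Finset V)) {X Y : Finset V}
    (h : X ⊆ Y) :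
    edgeWeight α E Y - edgeWeight α E X = ∑ c ∈ E with c.2 ⊆ Y ∧ ¬ c.2 ⊆ X, α c.1 := by
  simp only [edgeWeight, Finset.sum_filter, ← Finset.sum_sub_distrib]
  refine Finset.sum_congr rfl fun c _ => ?_
  have : c.2 ⊆ X → c.2 ⊆ Y := fun h' => h'.trans h
  by_cases hX : c.2 ⊆ X <;> by_cases hY : c.2 ⊆ Y <;> simp_all

lemma predim_sub (α : Fin p → ℝ) (E : Finset (Fin p × Finset V)) {X Y : Finset V}
    (h : X ⊆ Y) :
    predim α E Y - predim α E X =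
      ((Y \ X).card : ℝ) - ∑ c ∈ E with c.2 ⊆ Y ∧ ¬ c.2 ⊆ X, α c.1 := by
  rw [← edgeWeight_sub α E h, Finset.cast_card_sdiff h]
  simp only [predim]
  ring

/-- Negative relative predimensions of extensions of bounded size are bounded away from zero. -/
lemma exists_predim_gap (α : Fin p → ℝ) (hα : ∀ i, 0 < α i) (t : ℕ) :
    ∃ η : ℝ, 0 < η ∧ (∀ i, η ≤ α i) ∧
      ∀ {V : Type} (E : Finset (Fin p × Finset V)) (X Y : Finset V), X ⊆ Y → (Y \ X).card ≤ t →
        predim α E Y < predim α E X → predim α E Y ≤ predim α E X - η := by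
  obtain ⟨B, hB⟩ : ∃ B : ℕ, ∀ i, (t + 1 : ℝ) ≤ B * α i := by
    have h1 : ∀ i, ∃ B : ℕ, (t + 1 : ℝ) ≤ B * α i := fun i => by
      obtain ⟨B, hB⟩ := exists_nat_ge ((t + 1 : ℝ) / α i)
      exact ⟨B, (div_le_iff₀ (hα i)).1 hB⟩
    choose B hB using h1
    refine ⟨∑ i, B i, fun i => (hB i).trans ?_⟩
    have h2 : B i ≤ ∑ i, B i := Finset.single_le_sum (fun _ _ => Nat.zero_le _) (Finset.mem_univ i)
    have h3 : (B i : ℝ) ≤ ((∑ i, B i : ℕ) : ℝ) := by exact_mod_cast h2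
    exact mul_le_mul_of_nonneg_right h3 (hα i).le
  let val : Fin (t + 1) × (Fin p → Fin (B + 1)) → ℝ :=
    fun q => ∑ i, ((q.2 i : ℕ) : ℝ) * α i - (q.1 : ℕ)
  let s : Finset ℝ := insert 1 ((Finset.univ.image val).filter (0 < ·) ∪ Finset.univ.image α)
  have hs : s.Nonempty := ⟨1, by simp [s]⟩
  have hpos : ∀ y ∈ s, 0 < y := by
    intro y hy
    simp only [s, Finset.mem_insert, Finset.mem_union, Finset.mem_filter, Finset.mem_image,
      Finset.mem_univ, true_and] at hy
    rcases hy with rfl | ⟨_, h⟩ | ⟨i, rfl⟩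
    · exact one_pos
    · exact h
    · exact hα i
  refine ⟨s.min' hs, hpos _ (s.min'_mem hs), fun i => s.min'_le _ (by simp [s]), ?_⟩
  intro V E X Y hXY hcard hlt
  set E' := E.filter fun c => c.2 ⊆ Y ∧ ¬ c.2 ⊆ X with hE'
  have hsub := predim_sub α E hXY
  have hfib : ∑ c ∈ E', α c.1 = ∑ i, ((E'.filter fun c => c.1 = i).card : ℝ) * α i := by
    rw [← Finset.sum_fiberwise E' (fun c => c.1)]
    refine Finset.sum_congr rfl fun i _ => ?_
    rw [← nsmul_eq_mul, ← Finset.sum_const]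
    exact Finset.sum_congr rfl fun c hc => by rw [(Finset.mem_filter.1 hc).2]
  rw [← hE', hfib] at hsub
  have hcR : ((Y \ X).card : ℝ) ≤ t := by exact_mod_cast hcard
  by_cases hbig : ∃ i, B < (E'.filter fun c => c.1 = i).card
  · obtain ⟨i, hi⟩ := hbig
    have h1 : (B : ℝ) * α i ≤ ((E'.filter fun c => c.1 = i).card : ℝ) * α i :=
      mul_le_mul_of_nonneg_right (by exact_mod_cast hi.le) (hα i).le
    have h2 : ((E'.filter fun c => c.1 = i).card : ℝ) * α i ≤
        ∑ i, ((E'.filter fun c => c.1 = i).card : ℝ) * α i :=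
      Finset.single_le_sum (f := fun i => ((E'.filter fun c => c.1 = i).card : ℝ) * α i)
        (fun j _ => mul_nonneg (Nat.cast_nonneg _) (hα j).le) (Finset.mem_univ i)
    have h3 : s.min' hs ≤ 1 := s.min'_le _ (by simp [s])
    linarith [hB i]
  · push Not at hbig
    have hmem : predim α E X - predim α E Y ∈ s := by
      simp only [s, Finset.mem_insert, Finset.mem_union, Finset.mem_filter, Finset.mem_image,
        Finset.mem_univ, true_and]
      refine Or.inr (Or.inl ⟨⟨(⟨(Y \ X).card, by omega⟩,
        fun i => ⟨(E'.filter fun c => c.1 = i).card, Nat.lt_succ_of_le (hbig i)⟩), ?_⟩, ?_⟩)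
      · simp only [val]
        linarith
      · linarith
    linarith [s.min'_le _ hmem]

/-- In a hypergraph without small sets of negative predimension, every small set is contained in a
bounded set admitting no extension by at most `t` points that lowers the predimension. -/
lemma exists_closed_superset (α : Fin p → ℝ) (hα : ∀ i, 0 ≤ α i) {t : ℕ} {η : ℝ}
    (E : Finset (Fin p × Finset V))
    (hgap : ∀ X Y : Finset V, X ⊆ Y → (Y \ X).card ≤ t →
        predim α E Y < predim α E X → predim α E Y ≤ predim α E X - η)
    (u L : ℕ) (hL : (u : ℝ) < L * η)
    (hsparse : ∀ X : Finset V, X.card ≤ u + t * L → 0 ≤ predim α E X)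
    (X : Finset V) (hX : X.card ≤ u) :
    ∃ Z : Finset V, X ⊆ Z ∧ Z.card ≤ u + t * L ∧
      ∀ Y : Finset V, Z ⊆ Y → (Y \ Z).card ≤ t → predim α E Z ≤ predim α E Y := by
  by_contra! hcon
  have hchain : ∀ l : ℕ, l ≤ L → ∃ Z : Finset V, X ⊆ Z ∧ Z.card ≤ u + t * l ∧
      predim α E Z ≤ u - l * η := by
    intro l
    induction l with
    | zero =>
      intro _
      refine ⟨X, subset_rfl, by simpa using hX, ?_⟩
      have h1 : 0 ≤ edgeWeight α E X := Finset.sum_nonneg fun c _ => hα c.1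
      have h2 : (X.card : ℝ) ≤ u := by exact_mod_cast hX
      simp only [predim]
      push_cast
      linarith
    | succ l ih =>
      intro hl
      obtain ⟨Z, hXZ, hZ, hd⟩ := ih (by omega)
      obtain ⟨Y, hZY, hY, hlt⟩ := hcon Z hXZ (hZ.trans (by gcongr; omega))
      refine ⟨Y, hXZ.trans hZY, ?_, ?_⟩
      · have := Finset.card_sdiff_add_card_eq_card hZY
        rw [mul_add]
        omega
      · have := hgap Z Y hZY hY hlt
        push_cast
        linarith
  obtain ⟨Z, -, hZ, hd⟩ := hchain L le_rfl
  linarith [hsparse Z hZ]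

end Predimension

section FirstMoment

variable {V : Type*} [Fintype V]

/-- The sets of at most `s` points outside `Z` of relative predimension at most `d` over `Z`. -/
noncomputable def lowSets (α : Fin p → ℝ) (E : Finset (Fin p × Finset V)) (Z : Finset V) (s : ℕ)
    (d : ℝ) : Finset (Finset V) :=
  Finset.univ.filter fun Q =>
    Disjoint Q Z ∧ Q.card ≤ s ∧ predim α E (Q ∪ Z) - predim α E Z ≤ d

/-- The sets in `lowSets` all of whose subsets have nonnegative predimension over `Z`. -/
noncomputable def safeLowSets (α : Fin p → ℝ) (E : Finset (Fin p × Finset V)) (Z : Finset V)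
    (s : ℕ) (d : ℝ) : Finset (Finset V) :=
  (lowSets α E Z s d).filter fun Q => ∀ Q' ⊆ Q, predim α E Z ≤ predim α E (Q' ∪ Z)

lemma expect_low_le (α : Fin p → ℝ) (pr : Fin p × Finset V → ℝ)
    (hpr : ∀ c, 0 ≤ pr c ∧ pr c ≤ 1) (hn : 0 < Fintype.card V)
    (hprα : ∀ c, pr c ≤ (Fintype.card V : ℝ) ^ (-α c.1)) (N s : ℕ) (d : ℝ)
    (Z Q : Finset V) (hZ : Z.card ≤ N) (hQ : Q.card ≤ s) (hdisj : Disjoint Q Z) :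
    expect pr (fun T => if predim α T (Q ∪ Z) - predim α T Z ≤ d then 1 else 0) ≤
      2 ^ (p * 2 ^ (N + s)) * (Fintype.card V : ℝ) ^ (d - Q.card) := by
  have hn' : (0 : ℝ) < Fintype.card V := by exact_mod_cast hn
  have hn1 : (1 : ℝ) ≤ Fintype.card V := by exact_mod_cast hn
  set P : Finset (Fin p × Finset V) :=
    (Finset.univ ×ˢ (Q ∪ Z).powerset).filter fun c => ¬ c.2 ⊆ Z with hP
  have hPcard : P.card ≤ p * 2 ^ (N + s) := by
    refine (Finset.card_filter_le _ _).trans ?_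
    rw [Finset.card_product, Finset.card_powerset, Finset.card_univ, Fintype.card_fin]
    gcongr
    · norm_num
    · exact (Finset.card_union_le _ _).trans (by omega)
  set 𝓕 := P.powerset.filter fun F => (Q.card : ℝ) - ∑ c ∈ F, α c.1 ≤ d with h𝓕
  have hle : ∀ T : Finset (Fin p × Finset V),
      (if predim α T (Q ∪ Z) - predim α T Z ≤ d then (1 : ℝ) else 0) ≤
        ∑ F ∈ 𝓕, if F ⊆ T then (1 : ℝ) else 0 := by
    intro T
    split_ifs with h
    · have hsub := predim_sub α T (Finset.subset_union_right : Z ⊆ Q ∪ Z)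
      have hcard : ((Q ∪ Z) \ Z) = Q := by
        rw [Finset.union_sdiff_right, Finset.sdiff_eq_self_of_disjoint hdisj]
      rw [hcard] at hsub
      have hmem : (T.filter fun c => c.2 ⊆ Q ∪ Z ∧ ¬ c.2 ⊆ Z) ∈ 𝓕 := by
        rw [h𝓕, Finset.mem_filter, Finset.mem_powerset]
        refine ⟨fun c hc => ?_, by linarith⟩
        rw [Finset.mem_filter] at hc
        rw [hP, Finset.mem_filter, Finset.mem_product, Finset.mem_powerset]
        exact ⟨⟨Finset.mem_univ _, hc.2.1⟩, hc.2.2⟩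
      have := Finset.single_le_sum (f := fun F => if F ⊆ T then (1 : ℝ) else 0)
        (fun F _ => by positivity) hmem
      rwa [if_pos (Finset.filter_subset _ _)] at this
    · exact Finset.sum_nonneg fun F _ => by positivity
  refine (expect_mono hpr hle).trans ?_
  rw [expect_sum]
  simp only [expect_subset]
  have hterm : ∀ F ∈ 𝓕, ∏ c ∈ F, pr c ≤ (Fintype.card V : ℝ) ^ (d - Q.card) := by
    intro F hF
    rw [h𝓕, Finset.mem_filter] at hF
    calc ∏ c ∈ F, pr c ≤ ∏ c ∈ F, (Fintype.card V : ℝ) ^ (-α c.1) :=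
          Finset.prod_le_prod (fun c _ => (hpr c).1) fun c _ => hprα c
      _ = (Fintype.card V : ℝ) ^ (∑ c ∈ F, -α c.1) := by
          rw [Real.rpow_sum_of_pos hn']
      _ ≤ _ := by
          refine Real.rpow_le_rpow_of_exponent_le hn1 ?_
          rw [Finset.sum_neg_distrib]
          linarith [hF.2]
  refine (Finset.sum_le_card_nsmul _ _ _ hterm).trans ?_
  rw [nsmul_eq_mul]
  refine mul_le_mul_of_nonneg_right ?_ (Real.rpow_nonneg hn'.le _)
  have h1 : 𝓕.card ≤ 2 ^ (p * 2 ^ (N + s)) := by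
    refine (Finset.card_filter_le _ _).trans ?_
    rw [Finset.card_powerset]
    exact Nat.pow_le_pow_right (by norm_num) hPcard
  exact_mod_cast h1

lemma sum_rpow_neg_card_le (hn : 0 < Fintype.card V) (s : ℕ) :
    ∑ Q : Finset V with Q.card ≤ s, ((Fintype.card V : ℝ) ^ Q.card)⁻¹ ≤ s + 1 := by
  have hn' : (0 : ℝ) < Fintype.card V := by exact_mod_cast hn
  have h1 : (Finset.univ.filter fun Q : Finset V => Q.card ≤ s) =
      (Finset.range (s + 1)).biUnion fun u => Finset.powersetCard u Finset.univ := by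
    ext Q
    simp [Finset.mem_powersetCard]
  rw [h1]
  rw [Finset.sum_biUnion fun u _ u' _ h => Finset.pairwise_disjoint_powersetCard _ h]
  have h2 : ∀ u ∈ Finset.range (s + 1),
      ∑ Q ∈ Finset.powersetCard u (Finset.univ : Finset V),
        ((Fintype.card V : ℝ) ^ Q.card)⁻¹ ≤ 1 := by
    intro u _
    rw [Finset.sum_congr rfl (g := fun _ => ((Fintype.card V : ℝ) ^ u)⁻¹) fun Q hQ => by
      rw [(Finset.mem_powersetCard.1 hQ).2], Finset.sum_const, Finset.card_powersetCard,
      Finset.card_univ, nsmul_eq_mul, ← div_eq_mul_inv, div_le_one (pow_pos hn' _)]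
    exact_mod_cast Nat.choose_le_pow _ _
  refine (Finset.sum_le_card_nsmul _ _ _ h2).trans ?_
  simp

lemma expect_card_lowSets_le (α : Fin p → ℝ) (pr : Fin p × Finset V → ℝ)
    (hpr : ∀ c, 0 ≤ pr c ∧ pr c ≤ 1) (hn : 0 < Fintype.card V)
    (hprα : ∀ c, pr c ≤ (Fintype.card V : ℝ) ^ (-α c.1)) (N s : ℕ) (d : ℝ)
    (Z : Finset V) (hZ : Z.card ≤ N) :
    expect pr (fun T => ((lowSets α T Z s d).card : ℝ)) ≤
      ((s + 1) * 2 ^ (p * 2 ^ (N + s))) * (Fintype.card V : ℝ) ^ d := by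
  have hn' : (0 : ℝ) < Fintype.card V := by exact_mod_cast hn
  have h1 : ∀ T : Finset (Fin p × Finset V), ((lowSets α T Z s d).card : ℝ) =
      ∑ Q : Finset V with Disjoint Q Z ∧ Q.card ≤ s,
        if predim α T (Q ∪ Z) - predim α T Z ≤ d then 1 else 0 := by
    intro T
    rw [Finset.sum_boole, Finset.filter_filter, lowSets]
    simp only [and_assoc]
  simp only [h1]
  rw [expect_sum]
  calc _ ≤ ∑ Q : Finset V with Disjoint Q Z ∧ Q.card ≤ s,
        2 ^ (p * 2 ^ (N + s)) * (Fintype.card V : ℝ) ^ (d - Q.card) :=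
        Finset.sum_le_sum fun Q hQ => by
          rw [Finset.mem_filter] at hQ
          exact expect_low_le α pr hpr hn hprα N s d Z Q hZ hQ.2.2 hQ.2.1
    _ ≤ ∑ Q : Finset V with Q.card ≤ s,
        2 ^ (p * 2 ^ (N + s)) * (Fintype.card V : ℝ) ^ (d - Q.card) := by
        refine Finset.sum_le_sum_of_subset_of_nonneg ?_ fun Q _ _ => by positivity
        intro Q hQ
        simp only [Finset.mem_filter, Finset.mem_univ, true_and] at hQ ⊢
        exact hQ.2
    _ = 2 ^ (p * 2 ^ (N + s)) * (Fintype.card V : ℝ) ^ d *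
        ∑ Q : Finset V with Q.card ≤ s, ((Fintype.card V : ℝ) ^ Q.card)⁻¹ := by
        rw [Finset.mul_sum]
        refine Finset.sum_congr rfl fun Q _ => ?_
        rw [Real.rpow_sub hn', Real.rpow_natCast]
        ring
    _ ≤ 2 ^ (p * 2 ^ (N + s)) * (Fintype.card V : ℝ) ^ d * (s + 1) :=
        mul_le_mul_of_nonneg_left (sum_rpow_neg_card_le hn s) (by positivity)
    _ = _ := by ring

lemma biUnion_mem_lowSets (α : Fin p → ℝ) (hα : ∀ i, 0 ≤ α i) (E : Finset (Fin p × Finset V))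
    (Z : Finset V) (t : ℕ) (d : ℝ) {J : Type*} (q : J → Finset V)
    (hq : ∀ j, q j ∈ safeLowSets α E Z t d) (S : Finset J) :
    S.biUnion q ∈ lowSets α E Z (S.card * t) (S.card * d) := by
  simp only [safeLowSets, lowSets, Finset.mem_filter, Finset.mem_univ, true_and] at hq ⊢
  induction S using Finset.induction_on with
  | empty => simp
  | insert j S hj ih =>
    obtain ⟨ih1, ih2, ih3⟩ := ih
    obtain ⟨⟨h1, h2, h3⟩, h4⟩ := hq j
    rw [Finset.biUnion_insert, Finset.card_insert_of_notMem hj]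
    refine ⟨Finset.disjoint_union_left.2 ⟨h1, ih1⟩, ?_, ?_⟩
    · refine (Finset.card_union_le _ _).trans ?_
      rw [add_mul]
      omega
    · have hsub := predim_submodular α hα E (q j ∪ Z) (S.biUnion q ∪ Z)
      rw [← Finset.union_union_distrib_right, ← Finset.inter_union_distrib_right] at hsub
      have := h4 (q j ∩ S.biUnion q) Finset.inter_subset_left
      push_cast
      linarith

lemma card_safeLowSets_pow_le (α : Fin p → ℝ) (hα : ∀ i, 0 ≤ α i)
    (E : Finset (Fin p × Finset V)) (Z : Finset V) (t : ℕ) (d : ℝ) (r : ℕ) :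
    (safeLowSets α E Z t d).card ^ r ≤
      (2 ^ (r * t)) ^ r * (lowSets α E Z (r * t) (r * d)).card := by
  have hcard : (Fintype.piFinset fun _ : Fin r => safeLowSets α E Z t d).card =
      (safeLowSets α E Z t d).card ^ r := by simp
  rw [← hcard]
  have hmaps : ∀ q ∈ Fintype.piFinset (fun _ : Fin r => safeLowSets α E Z t d),
      Finset.univ.biUnion q ∈ lowSets α E Z (r * t) (r * d) := by
    intro q hq
    rw [Fintype.mem_piFinset] at hq
    simpa using biUnion_mem_lowSets α hα E Z t d q hq Finset.univ
  refine Finset.card_le_mul_card_image_of_maps_to hmaps _ ?_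
  intro Q hQ
  have hQcard : Q.card ≤ r * t := by
    simp only [lowSets, Finset.mem_filter] at hQ
    exact hQ.2.2.1
  calc _ ≤ (Fintype.piFinset fun _ : Fin r => Q.powerset).card := by
        refine Finset.card_le_card fun q hq => ?_
        rw [Finset.mem_filter] at hq
        rw [Fintype.mem_piFinset]
        intro j
        rw [Finset.mem_powerset, ← hq.2]
        exact Finset.subset_biUnion_of_mem q (Finset.mem_univ j)
    _ ≤ _ := by
        simp only [Fintype.card_piFinset, Finset.card_powerset, Finset.prod_const,
          Finset.card_univ, Fintype.card_fin]
        gcongr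
        norm_num

/-- Markov's inequality for a high power of the number of safe sets of low predimension. -/
lemma expect_many_safeLowSets_le (α : Fin p → ℝ) (hα : ∀ i, 0 ≤ α i) (pr : Fin p × Finset V → ℝ)
    (hpr : ∀ c, 0 ≤ pr c ∧ pr c ≤ 1) (hn : 0 < Fintype.card V)
    (hprα : ∀ c, pr c ≤ (Fintype.card V : ℝ) ^ (-α c.1)) (N t r : ℕ) (d : ℝ)
    (Z : Finset V) (hZ : Z.card ≤ N) (k : ℝ) (hk : 0 < k) :
    expect pr (fun T => if k ≤ (safeLowSets α T Z t d).card then 1 else 0) ≤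
      ((2 ^ (r * t)) ^ r * ((r * t + 1) * 2 ^ (p * 2 ^ (N + r * t)))) *
        ((Fintype.card V : ℝ) ^ d / k) ^ r := by
  have h1 : ∀ T : Finset (Fin p × Finset V),
      (if k ≤ ((safeLowSets α T Z t d).card : ℝ) then (1 : ℝ) else 0) ≤
        ((2 ^ (r * t)) ^ r / k ^ r) * ((lowSets α T Z (r * t) (r * d)).card : ℝ) := by
    intro T
    split_ifs with h
    · have h2 : k ^ r ≤ ((safeLowSets α T Z t d).card : ℝ) ^ r := pow_le_pow_left₀ hk.le h r
      have h3 : ((safeLowSets α T Z t d).card : ℝ) ^ r ≤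
          (2 ^ (r * t)) ^ r * ((lowSets α T Z (r * t) (r * d)).card : ℝ) := by
        exact_mod_cast card_safeLowSets_pow_le α hα T Z t d r
      rw [div_mul_eq_mul_div, le_div_iff₀ (by positivity), one_mul]
      exact h2.trans h3
    · positivity
  refine (expect_mono hpr h1).trans ?_
  rw [expect_const_mul]
  have h2 := expect_card_lowSets_le α pr hpr hn hprα N (r * t) (r * d) Z hZ
  refine (mul_le_mul_of_nonneg_left h2 (by positivity)).trans (le_of_eq ?_)
  have hn' : (0 : ℝ) ≤ Fintype.card V := by positivity
  rw [mul_comm (r : ℝ) d, Real.rpow_mul hn', Real.rpow_natCast, div_pow]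
  push_cast
  field_simp

end FirstMoment

section Structures

variable {M : Type*} [Fintype M] {k : Fin p → ℕ} [(Lang p k).Structure M]

/-- The edges of the hypergraph underlying a structure. -/
noncomputable def edgesOf (k : Fin p → ℕ) (M : Type*) [Fintype M] [(Lang p k).Structure M] :
    Finset (Fin p × Finset M) :=
  Finset.univ.filter fun c => HoldsOn k c.1 c.2

lemma mem_edgesOf {c : Fin p × Finset M} : c ∈ edgesOf k M ↔ HoldsOn k c.1 c.2 := by
  simp [edgesOf]

omit [Fintype M] in
lemma HoldsOn.card_eq {i : Fin p} {S : Finset M} (h : HoldsOn k i S) : S.card = k i := by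
  obtain ⟨v, hv, rfl, -⟩ := h
  rw [Finset.card_image_of_injective _ hv]
  simp

lemma delta_eq_predim (α : Fin p → ℝ) (X : Finset M) :
    delta k α X = predim α (edgesOf k M) X := by
  rw [delta, predim, eVal, edgeWeight,
    ← Finset.sum_fiberwise ((edgesOf k M).filter fun c => c.2 ⊆ X) (fun c => c.1)]
  congr 1
  refine Finset.sum_congr rfl fun i _ => ?_
  rw [Finset.sum_congr rfl (g := fun _ => α i) fun c hc => by rw [(Finset.mem_filter.1 hc).2],
    Finset.sum_const, nsmul_eq_mul, mul_comm]
  congr 2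
  rw [w, ← Set.ncard_coe_finset]
  refine Set.ncard_congr (fun S _ => (i, S)) ?_ ?_ ?_
  · intro S hS
    simp [mem_edgesOf, hS.1, hS.2.2]
  · intro S S' _ _ h
    exact (Prod.mk.inj h).2
  · rintro ⟨i', S⟩ hS
    simp only [Finset.coe_filter, Finset.mem_filter, Set.mem_ofPred_eq, mem_edgesOf] at hS
    obtain ⟨⟨h1, h2⟩, rfl⟩ := hS
    exact ⟨S, ⟨h2, h1.card_eq, h1⟩, rfl⟩

lemma bddBelow_delta (α : Fin p → ℝ) (B X : Finset M) :
    BddBelow {r : ℝ | ∃ Y : Finset M, X ⊆ Y ∧ Y ⊆ B ∧ r = delta k α Y} :=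
  ((Set.finite_range fun Y : Finset M => delta k α Y).subset
    (by rintro r ⟨Y, -, -, rfl⟩; exact ⟨Y, rfl⟩)).bddBelow

lemma strongIn_of_delta_le {α : Fin p → ℝ} (hα : ∀ i, 0 ≤ α i) {A B : Finset M} (hAB : A ⊆ B)
    (h : ∀ Y, A ⊆ Y → Y ⊆ B → delta k α A ≤ delta k α Y) : StrongIn k α A B := by
  refine ⟨hAB, fun X hX => le_antisymm ?_ ?_⟩
  · refine le_csInf ⟨_, X, subset_rfl, hX.trans hAB, rfl⟩ ?_
    rintro r ⟨Y, hXY, hYB, rfl⟩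
    refine (csInf_le (bddBelow_delta α A X)
      ⟨Y ∩ A, Finset.subset_inter hXY hX, Finset.inter_subset_right, rfl⟩).trans ?_
    have h1 := h (Y ∪ A) Finset.subset_union_right (Finset.union_subset hYB hAB)
    have h2 := predim_submodular α hα (edgesOf k M) Y A
    simp only [delta_eq_predim] at h1 ⊢
    linarith
  · refine le_csInf ⟨_, X, subset_rfl, hX, rfl⟩ ?_
    rintro r ⟨Y, hXY, hYA, rfl⟩
    exact csInf_le (bddBelow_delta α B X) ⟨Y, hXY, hYA.trans hAB, rfl⟩

lemma intrinsicIn_iff {α : Fin p → ℝ} (hα : ∀ i, 0 ≤ α i) {A B : Finset M} :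
    IntrinsicIn k α A B ↔ A ⊆ B ∧ ∀ X, A ⊆ X → X ⊂ B →
      predim α (edgesOf k M) B < predim α (edgesOf k M) X := by
  refine and_congr_right fun hAB => ⟨fun h X hAX hXB => ?_, fun h X hAX hXB hs => ?_⟩
  · by_contra! hle
    obtain ⟨Y, hY, hmin⟩ := Finset.exists_min_image
      ((Finset.univ : Finset (Finset M)).filter fun Y => X ⊆ Y ∧ Y ⊂ B)
      (fun Y => predim α (edgesOf k M) Y) ⟨X, by simpa using hXB⟩
    simp only [Finset.mem_filter, Finset.mem_univ, true_and] at hY hmin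
    refine h Y (hAX.trans hY.1) hY.2 (strongIn_of_delta_le hα hY.2.subset fun Z hYZ hZB => ?_)
    rw [delta_eq_predim, delta_eq_predim]
    rcases hZB.eq_or_ssubset with rfl | hZB
    · exact (hmin X ⟨subset_rfl, hXB⟩).trans hle
    · exact hmin Z ⟨hY.1.trans hYZ, hZB⟩
  · have h1 := hs.2 X subset_rfl
    have h2 : dRel k α X X = delta k α X := by
      have : {r : ℝ | ∃ Y : Finset M, X ⊆ Y ∧ Y ⊆ X ∧ r = delta k α Y} = {delta k α X} := by
        ext r
        constructor
        · rintro ⟨Y, h1, h2, rfl⟩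
          rw [subset_antisymm h1 h2]
          rfl
        · rintro rfl
          exact ⟨X, subset_rfl, subset_rfl, rfl⟩
      rw [dRel, this, csInf_singleton]
    have h3 : dRel k α B X ≤ delta k α B :=
      csInf_le (bddBelow_delta α B X) ⟨B, hXB.subset, subset_rfl, rfl⟩
    rw [← h1, h2, delta_eq_predim, delta_eq_predim] at h3
    exact absurd (h X hAX hXB) (not_lt.2 h3)

omit [Fintype M] in
lemma holdsOn_image_iff (hM : SymmIrr k M) {i : Fin p} {v : Fin (k i) → M}
    (hv : Function.Injective v) : HoldsOn k i (Finset.image v Finset.univ) ↔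
      Language.Structure.RelMap (L := Lang p k) (⟨i, rfl⟩ : (Lang p k).Relations (k i)) v := by
  refine ⟨?_, fun h => ⟨v, hv, rfl, h⟩⟩
  rintro ⟨u, hu, huv, h⟩
  have h1 : ∀ j, ∃ j', u j' = v j := fun j => by
    have : v j ∈ Finset.image u Finset.univ := by simp [huv]
    simpa using this
  choose σ hσ using h1
  have hinj : Function.Injective σ := fun a b hab => hv (by rw [← hσ, ← hσ, hab])
  have h2 := hM.2 _ _ u (Equiv.ofBijective σ (Finite.injective_iff_bijective.1 hinj)) h
  convert h2 using 1
  funext j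
  exact (hσ j).symm

omit [Fintype M] in
lemma IsEmbOn.holdsOn_iff {N : Type*} [(Lang p k).Structure N] {A : Finset M} {f : M → N}
    (hf : IsEmbOn k A f) {i : Fin p} {S : Finset M} (hS : S ⊆ A) :
    HoldsOn k i (S.image f) ↔ HoldsOn k i S := by
  constructor
  · intro h
    have hcard := h.card_eq
    obtain ⟨u, hu, huS, hr⟩ := h
    have h1 : ∀ j, ∃ a ∈ S, f a = u j := fun j => by
      have : u j ∈ S.image f := by simp [← huS]
      simpa using this
    choose v hvS hv using h1
    have hfv : f ∘ v = u := funext hv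
    have hinj : Function.Injective v := fun a b hab => hu (by rw [← hv, ← hv, hab])
    refine ⟨v, hinj, Finset.eq_of_subset_of_card_le ?_ ?_, ?_⟩
    · intro a ha
      simp only [Finset.mem_image, Finset.mem_univ, true_and] at ha
      obtain ⟨j, rfl⟩ := ha
      exact hvS j
    · rw [Finset.card_image_of_injective _ hinj, Finset.card_univ, Fintype.card_fin, ← hcard,
        Finset.card_image_of_injOn (hf.1.mono hS)]
    · exact (hf.2 _ _ v fun j => hS (hvS j)).1 (hfv ▸ hr)
  · rintro ⟨v, hv, rfl, hr⟩
    have hvA : ∀ j, v j ∈ A := fun j => hS (by simp)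
    refine ⟨f ∘ v, fun a b hab => hv (hf.1 (hvA a) (hvA b) hab), ?_, (hf.2 _ _ v hvA).2 hr⟩
    rw [Finset.image_image]

omit [Fintype M] in
lemma isEmbOn_of_holdsOn_iff {N : Type*} [(Lang p k).Structure N] (hM : SymmIrr k M)
    (hN : SymmIrr k N) {A : Finset M} {f : M → N} (hf : Set.InjOn f ↑A)
    (h : ∀ i, ∀ S ⊆ A, (HoldsOn k i (S.image f) ↔ HoldsOn k i S)) : IsEmbOn k A f := by
  refine ⟨hf, ?_⟩
  rintro n ⟨i, rfl⟩ v hv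
  by_cases hinj : Function.Injective v
  · have hinj' : Function.Injective (f ∘ v) := fun a b hab => hinj (hf (hv a) (hv b) hab)
    have h1 := h i (Finset.image v Finset.univ) fun a ha => by
      simp only [Finset.mem_image, Finset.mem_univ, true_and] at ha
      obtain ⟨j, rfl⟩ := ha
      exact hv j
    rw [Finset.image_image, holdsOn_image_iff hN hinj', holdsOn_image_iff hM hinj] at h1
    exact h1
  · exact ⟨fun hr => absurd (hN.1 _ _ _ hr).of_comp hinj, fun hr => absurd (hM.1 _ _ _ hr) hinj⟩

end Structures

section GenericExtension

lemma image_eq_image_of_injOn {U V : Type*} {g : U → V} {B S S' : Finset U}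
    (hg : Set.InjOn g ↑B) (hS : S ⊆ B) (hS' : S' ⊆ B) (h : S.image g = S'.image g) : S = S' := by
  refine Finset.coe_injective ((hg.image_eq_image_iff (by exact_mod_cast hS)
    (by exact_mod_cast hS')).1 ?_)
  rw [← Finset.coe_image, h, Finset.coe_image]

/-- `g` carries every edge of `B` not contained in `A` to an edge. -/
def EdgesPresent {U V : Type*} (E : Finset (Fin p × Finset U)) (ω : Finset (Fin p × Finset V))
    (A B : Finset U) (g : U → V) : Prop :=
  ∀ c ∈ E, c.2 ⊆ B → ¬ c.2 ⊆ A → (c.1, c.2.image g) ∈ ω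

/-- If `g` preserves the edges of `B` over `A`, then the image of `B` has at most the expected
predimension over `Z`, and a smaller one if there are further edges. -/
lemma predim_image_le {U V : Type*} (α : Fin p → ℝ) (hα : ∀ i, 0 < α i)
    (E : Finset (Fin p × Finset U)) (ω : Finset (Fin p × Finset V)) {A B : Finset U} (hAB : A ⊆ B)
    {g : U → V} {Z : Finset V} (hgA : ∀ a ∈ A, g a ∈ Z) (hgZ : ∀ b ∈ B \ A, g b ∉ Z)
    (hinj : Set.InjOn g ↑B) (hpres : EdgesPresent E ω A B g) :
    predim α ω (B.image g ∪ Z) - predim α ω Z ≤ predim α E B - predim α E A ∧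
      ∀ c ∈ ω, c.2 ⊆ B.image g ∪ Z → ¬ c.2 ⊆ Z →
        (∃ S ⊆ B, (c.1, S) ∈ E ∧ c.2 = S.image g) ∨
          predim α ω (B.image g ∪ Z) - predim α ω Z ≤ predim α E B - predim α E A - α c.1 := by
  have hcard : ((B.image g ∪ Z) \ Z).card = (B \ A).card := by
    rw [← Finset.card_image_of_injOn (hinj.mono (by exact_mod_cast Finset.sdiff_subset) :
      Set.InjOn g ↑(B \ A))]
    congr 1
    ext x
    simp only [Finset.mem_sdiff, Finset.mem_union, Finset.mem_image]
    constructor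
    · rintro ⟨⟨b, hb, rfl⟩ | h, hx⟩
      · exact ⟨b, ⟨hb, fun h => hx (hgA b h)⟩, rfl⟩
      · exact absurd h hx
    · rintro ⟨b, hb, rfl⟩
      exact ⟨.inl ⟨b, hb.1, rfl⟩, hgZ b (by simpa using hb)⟩
  rw [predim_sub α ω (Finset.subset_union_right : Z ⊆ B.image g ∪ Z), predim_sub α E hAB, hcard]
  set EB := E.filter fun c => c.2 ⊆ B ∧ ¬ c.2 ⊆ A with hEB
  set W := ω.filter fun c => c.2 ⊆ B.image g ∪ Z ∧ ¬ c.2 ⊆ Z with hW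
  set P := EB.image fun c => (c.1, c.2.image g) with hP
  have hPW : P ⊆ W := by
    intro c hc
    obtain ⟨c, hc', rfl⟩ := Finset.mem_image.1 hc
    clear hc
    rename' hc' => hc
    simp only [hEB, hW, Finset.mem_filter] at hc ⊢
    refine ⟨hpres c hc.1 hc.2.1 hc.2.2,
      (Finset.image_subset_image hc.2.1).trans Finset.subset_union_left, fun h => ?_⟩
    obtain ⟨x, hx, hxA⟩ := Finset.not_subset.1 hc.2.2
    exact hgZ x (Finset.mem_sdiff.2 ⟨hc.2.1 hx, hxA⟩) (h (Finset.mem_image_of_mem g hx))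
  have hsum : ∑ c ∈ P, α c.1 = ∑ c ∈ EB, α c.1 := by
    rw [hP, Finset.sum_image]
    rintro ⟨i, S⟩ hc ⟨i', S'⟩ hc' h
    simp only [hEB, Finset.coe_filter, Set.mem_ofPred_eq] at hc hc'
    obtain ⟨rfl, h⟩ := Prod.mk.inj h
    rw [image_eq_image_of_injOn hinj hc.2.1 hc'.2.1 h]
  refine ⟨?_, fun c hc h1 h2 => ?_⟩
  · have := Finset.sum_le_sum_of_subset_of_nonneg hPW fun c _ _ => (hα c.1).le
    linarith
  · by_cases hcP : c ∈ P
    · left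
      obtain ⟨c', hc', rfl⟩ := Finset.mem_image.1 hcP
      simp only [hEB, Finset.mem_filter] at hc'
      exact ⟨c'.2, hc'.2.1, hc'.1, rfl⟩
    · right
      have := Finset.sum_le_sum_of_subset_of_nonneg
        (Finset.insert_subset (Finset.mem_filter.2 ⟨hc, h1, h2⟩) hPW)
        (f := fun c => α c.1) fun c _ _ => (hα c.1).le
      rw [Finset.sum_insert hcP] at this
      linarith

variable {k : Fin p → ℕ} {U V : Type*} [Fintype U] [Fintype V] [(Lang p k).Structure U]
  [(Lang p k).Structure V]

lemma mem_cl_iff {α : Fin p → ℝ} (hα : ∀ i, 0 ≤ α i) {m : ℕ} {A : Finset V} {x : V} :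
    x ∈ cl k α m A ↔ ∃ D, (A ⊆ D ∧ ∀ X, A ⊆ X → X ⊂ D →
      predim α (edgesOf k V) D < predim α (edgesOf k V) X) ∧ (D \ A).card < m ∧ x ∈ D := by
  simp only [cl, ← intrinsicIn_iff hα]
  rfl

/-- An extension without dense subsets over a closed set is free and does not enlarge the
closure. -/
lemma free_extension_of_no_dense (hU : SymmIrr k U) (hV : SymmIrr k V)
    {α : Fin p → ℝ} (hα : ∀ i, 0 < α i) {η : ℝ} (hη : ∀ i, η ≤ α i)
    {t m : ℕ} (hm : 0 < m)
    (hgap : ∀ X Y : Finset V, X ⊆ Y → (Y \ X).card ≤ t →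
      predim α (edgesOf k V) Y < predim α (edgesOf k V) X →
        predim α (edgesOf k V) Y ≤ predim α (edgesOf k V) X - η)
    {A B C : Finset U} (hAB : A ⊆ B) (hAC : A ⊆ C) (ht : (B \ A).card + m ≤ t)
    {f g : U → V} (hf : IsEmbOn k C f) (hfg : ∀ a ∈ A, g a = f a)
    (hcl : (↑(C.image f) : Set V) = cl k α m (A.image f))
    {Z : Finset V} (hCZ : C.image f ⊆ Z) (hgZ : ∀ b ∈ B \ A, g b ∉ Z)
    (hginj : Set.InjOn g ↑(B \ A))
    (hpres : EdgesPresent (edgesOf k U) (edgesOf k V) A B g)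
    (hdense : ∀ T : Finset V, Disjoint T Z → T.card ≤ t → (B \ A).image g ⊆ T →
      predim α (edgesOf k U) B - predim α (edgesOf k U) A - η <
        predim α (edgesOf k V) (T ∪ Z) - predim α (edgesOf k V) Z) :
    IsEmbOn k B g ∧ B.image g ∩ C.image f = A.image f ∧
      FreelyJoined k (↑(A.image f) : Set V) ↑(C.image f) ↑(B.image g) ∧
      cl k α m (B.image g) = ↑(B.image g) ∪ (↑(C.image f) : Set V) := by
  have hα' : ∀ i, 0 ≤ α i := fun i => (hα i).le
  have hgA : ∀ a ∈ A, g a ∈ Z := fun a ha => by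
    rw [hfg a ha]
    exact hCZ (Finset.mem_image_of_mem f (hAC ha))
  have hinj : Set.InjOn g ↑B := by
    intro a ha b hb hab
    simp only [Finset.mem_coe] at ha hb
    by_cases haA : a ∈ A <;> by_cases hbA : b ∈ A
    · rw [hfg a haA, hfg b hbA] at hab
      exact hf.1 (hAC haA) (hAC hbA) hab
    · exact absurd (hab ▸ hgA a haA) (hgZ b (Finset.mem_sdiff.2 ⟨hb, hbA⟩))
    · exact absurd (hab.symm ▸ hgA b hbA) (hgZ a (Finset.mem_sdiff.2 ⟨ha, haA⟩))
    · exact hginj (by simp [ha, haA]) (by simp [hb, hbA]) hab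
  have himA : A.image g = A.image f := Finset.image_congr fun a ha => hfg a ha
  have hfAB : A.image f ⊆ B.image g := himA ▸ Finset.image_subset_image hAB
  have hfAC : A.image f ⊆ C.image f := Finset.image_subset_image hAC
  set ω := edgesOf k V with hω
  set gB := B.image g with hgB
  set δ := predim α (edgesOf k U) B - predim α (edgesOf k U) A with hδ
  have hinter : gB ∩ Z ⊆ A.image f := by
    intro x hx
    obtain ⟨hx1, hx2⟩ := Finset.mem_inter.1 hx
    obtain ⟨b, hb, rfl⟩ := Finset.mem_image.1 hx1
    by_cases hbA : b ∈ A
    · rw [hfg b hbA]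
      exact Finset.mem_image_of_mem f hbA
    · exact absurd hx2 (hgZ b (Finset.mem_sdiff.2 ⟨hb, hbA⟩))
  have hRcard : ((B \ A).image g).card ≤ (B \ A).card := Finset.card_image_le
  have hgBZ : gB ∪ Z = (B \ A).image g ∪ Z := by
    ext x
    simp only [hgB, Finset.mem_union, Finset.mem_image, Finset.mem_sdiff]
    constructor
    · rintro (⟨b, hb, rfl⟩ | h)
      · by_cases hbA : b ∈ A
        · exact .inr (hgA b hbA)
        · exact .inl ⟨b, ⟨hb, hbA⟩, rfl⟩
      · exact .inr h
    · rintro (⟨b, hb, rfl⟩ | h)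
      · exact .inl ⟨b, hb.1, rfl⟩
      · exact .inr h
  have hRZ : Disjoint ((B \ A).image g) Z := by
    rw [Finset.disjoint_left]
    intro x hx
    obtain ⟨b, hb, rfl⟩ := Finset.mem_image.1 hx
    exact hgZ b hb
  obtain ⟨hle, hedge⟩ := predim_image_le α hα (edgesOf k U) ω hAB hgA hgZ hinj hpres
  have hedges : ∀ c ∈ ω, c.2 ⊆ gB ∪ Z → ¬ c.2 ⊆ Z →
      ∃ S ⊆ B, (c.1, S) ∈ edgesOf k U ∧ c.2 = S.image g := by
    intro c hc h1 h2
    rcases hedge c hc h1 h2 with h | h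
    · exact h
    · have h3 := hdense _ hRZ (by omega) subset_rfl
      rw [← hgBZ] at h3
      have := hη c.1
      linarith
  have hedges' : ∀ c ∈ ω, c.2 ⊆ gB ∪ Z → c.2 ⊆ gB ∨ c.2 ⊆ Z := by
    intro c hc h1
    by_contra! h
    obtain ⟨S, hS, -, h3⟩ := hedges c hc h1 h.2
    exact h.1 (h3 ▸ Finset.image_subset_image hS)
  have hinterC : gB ∩ C.image f = A.image f :=
    subset_antisymm ((Finset.inter_subset_inter_left hCZ).trans hinter)
      (Finset.subset_inter hfAB hfAC)
  have hinterZ : gB ∩ Z = A.image f :=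
    subset_antisymm hinter (Finset.subset_inter hfAB (hfAC.trans hCZ))
  refine ⟨isEmbOn_of_holdsOn_iff hU hV hinj fun i S hS => ?_, hinterC, ⟨?_, ?_⟩, ?_⟩
  · by_cases hSA : S ⊆ A
    · rw [Finset.image_congr fun a ha => hfg a (hSA ha)]
      exact hf.holdsOn_iff (hSA.trans hAC)
    · obtain ⟨x, hx, hxA⟩ := Finset.not_subset.1 hSA
      constructor
      · intro h
        obtain ⟨S', hS', h1, h2⟩ := hedges (i, S.image g) (mem_edgesOf.2 h)
          ((Finset.image_subset_image hS).trans Finset.subset_union_left)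
          fun h => hgZ x (Finset.mem_sdiff.2 ⟨hS hx, hxA⟩) (h (Finset.mem_image_of_mem g hx))
        rw [image_eq_image_of_injOn hinj hS hS' h2]
        exact mem_edgesOf.1 h1
      · intro h
        exact mem_edgesOf.1 (hpres (i, S) (mem_edgesOf.2 h) hS hSA)
  · rw [← hinterC, Finset.coe_inter, Set.inter_comm]
  · intro i S hS h
    have hS' : S ⊆ C.image f ∪ gB := by exact_mod_cast hS
    rcases hedges' (i, S) (mem_edgesOf.2 h) (hS'.trans
      (Finset.union_subset (hCZ.trans Finset.subset_union_right) Finset.subset_union_left)) with h1 | h1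
    · exact .inr (by exact_mod_cast h1)
    · left
      intro x hx
      rcases Finset.mem_union.1 (hS' hx) with h2 | h2
      · exact h2
      · exact hfAC (hinter (Finset.mem_inter.2 ⟨h2, h1 hx⟩))
  · refine subset_antisymm (fun x hx => ?_) (Set.union_subset (fun x hx => ?_) fun x hx => ?_)
    · obtain ⟨D, ⟨hD1, hD2⟩, hD3, hxD⟩ := (mem_cl_iff hα').1 hx
      have hDsub : D ⊆ gB ∪ Z := by
        by_contra hD
        have hXD : D ∩ (gB ∪ Z) ⊂ D := by
          refine Finset.ssubset_iff_subset_ne.2 ⟨Finset.inter_subset_left, fun h => hD ?_⟩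
          exact Finset.inter_eq_left.1 h
        have hX : gB ⊆ D ∩ (gB ∪ Z) := Finset.subset_inter hD1 Finset.subset_union_left
        have h1 := hgap _ _ hXD.subset
          ((Finset.card_le_card (Finset.sdiff_subset_sdiff subset_rfl hX)).trans (by omega))
          (hD2 _ hX hXD)
        have h2 := predim_submodular α hα' ω D (gB ∪ Z)
        have h3 := hdense ((D ∪ (gB ∪ Z)) \ Z) Finset.sdiff_disjoint ?_ ?_
        · rw [Finset.sdiff_union_of_subset
            (Finset.subset_union_right.trans Finset.subset_union_right)] at h3
          linarith
        · refine (Finset.card_le_card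
            (?_ : _ ⊆ (B \ A).image g ∪ D \ gB)).trans ((Finset.card_union_le _ _).trans (by omega))
          intro y hy
          simp only [hgBZ, Finset.mem_sdiff, Finset.mem_union] at hy ⊢
          have : y ∈ gB → y ∈ (B \ A).image g ∨ y ∈ Z := fun h => by
            rw [← Finset.mem_union, ← hgBZ]
            exact Finset.mem_union_left _ h
          tauto
        · intro y hy
          refine Finset.mem_sdiff.2 ⟨?_, Finset.disjoint_left.1 hRZ hy⟩
          rw [hgBZ]
          exact Finset.mem_union_right _ (Finset.mem_union_left _ hy)
      rcases Finset.mem_union.1 (hDsub hxD) with h | h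
      · exact .inl (by exact_mod_cast h)
      right
      rw [hcl, mem_cl_iff hα']
      have hDeq : gB ∪ D ∩ Z = D := by
        ext y
        have h1 := @hDsub y
        have h2 := @hD1 y
        simp only [Finset.mem_union, Finset.mem_inter] at h1 ⊢
        tauto
      refine ⟨D ∩ Z, ⟨Finset.subset_inter (hfAB.trans hD1) (hfAC.trans hCZ), fun Y hY hYD => ?_⟩,
        ?_, Finset.mem_inter.2 ⟨hxD, h⟩⟩
      · have h1 := predim_add_le_of_free α ω gB (D ∩ Z) fun c hc h => by
          rcases hedges' c hc (h.trans (Finset.union_subset_union_right Finset.inter_subset_right))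
            with h1 | h1
          · exact .inl h1
          · exact .inr (Finset.subset_inter (hDeq ▸ h) h1)
        have h2 := predim_submodular α hα' ω gB Y
        have h3 : gB ∩ (D ∩ Z) = A.image f := by
          rw [← hinterZ]
          ext y
          have := @hD1 y
          simp only [Finset.mem_inter]
          tauto
        have h4 : gB ∩ Y = A.image f := by
          refine subset_antisymm ?_ (Finset.subset_inter hfAB hY)
          rw [← h3]
          exact Finset.inter_subset_inter_left hYD.subset
        have h5 : gB ∪ Y ⊂ D := by
          refine Finset.ssubset_iff_subset_ne.2
            ⟨Finset.union_subset hD1 (hYD.subset.trans Finset.inter_subset_left), fun h => ?_⟩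
          refine hYD.not_subset fun y hy => ?_
          have hyD : y ∈ gB ∪ Y := h ▸ (Finset.mem_inter.1 hy).1
          rcases Finset.mem_union.1 hyD with h6 | h6
          · exact hY (h3 ▸ Finset.mem_inter.2 ⟨h6, hy⟩)
          · exact h6
        have h6 := hD2 _ Finset.subset_union_left h5
        rw [h3, hDeq] at h1
        rw [h4] at h2
        linarith
      · refine lt_of_le_of_lt (Finset.card_le_card fun y hy => ?_) hD3
        obtain ⟨hy1, hy2⟩ := Finset.mem_sdiff.1 hy
        obtain ⟨hy1, hy3⟩ := Finset.mem_inter.1 hy1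
        exact Finset.mem_sdiff.2 ⟨hy1, fun h => hy2 (hinter (Finset.mem_inter.2 ⟨h, hy3⟩))⟩
    · refine (mem_cl_iff hα').2 ⟨gB, ⟨subset_rfl, fun X h1 h2 => absurd h1 h2.not_subset⟩, ?_,
        by exact_mod_cast hx⟩
      simpa using hm
    · have hx' := hx
      rw [hcl, mem_cl_iff hα'] at hx'
      obtain ⟨D, ⟨hD1, hD2⟩, hD3, hxD⟩ := hx'
      refine (mem_cl_iff hα').2 ⟨gB ∪ D, ⟨Finset.subset_union_left, fun X h1 h2 => ?_⟩, ?_,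
        Finset.mem_union_right _ hxD⟩
      · have h3 := predim_submodular α hα' ω X D
        have h4 : X ∪ D = gB ∪ D := by
          refine subset_antisymm (Finset.union_subset h2.subset Finset.subset_union_right)
            (Finset.union_subset_union_left h1)
        have h5 := hD2 (X ∩ D) (Finset.subset_inter (hfAB.trans h1) hD1)
          (Finset.ssubset_iff_subset_ne.2 ⟨Finset.inter_subset_right, fun h => h2.not_subset
            (Finset.union_subset h1 (Finset.inter_eq_right.1 h))⟩)
        rw [h4] at h3
        linarith
      · refine lt_of_le_of_lt (Finset.card_le_card fun y hy => ?_) hD3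
        obtain ⟨hy1, hy2⟩ := Finset.mem_sdiff.1 hy
        rcases Finset.mem_union.1 hy1 with h | h
        · exact absurd h hy2
        · exact Finset.mem_sdiff.2 ⟨h, fun h' => hy2 (hfAB h')⟩

end GenericExtension

section Copies

/-- Replace the values of `f` on `D` by those of `h`. -/
noncomputable def extendOn {U V : Type*} (D : Finset U) (f : U → V) (h : {u // u ∈ D} → V) : U → V :=
  fun u => if hu : u ∈ D then h ⟨u, hu⟩ else f u

lemma extendOn_of_mem {U V : Type*} {D : Finset U} (f : U → V) (h : {u // u ∈ D} → V) {u : U}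
    (hu : u ∈ D) : extendOn D f h u = h ⟨u, hu⟩ := dif_pos hu

lemma extendOn_of_notMem {U V : Type*} {D : Finset U} (f : U → V) (h : {u // u ∈ D} → V) {u : U}
    (hu : u ∉ D) : extendOn D f h u = f u := dif_neg hu

/-- The ways to place `B \ A` injectively outside `Z` so that all edges of `B` over `A` are
present. -/
noncomputable def copies {U V : Type*} [Fintype V] (E : Finset (Fin p × Finset U))
    (ω : Finset (Fin p × Finset V)) (A B : Finset U) (f : U → V) (Z : Finset V) :
    Finset ({u // u ∈ B \ A} → V) :=
  Finset.univ.filter fun h => Function.Injective h ∧ (∀ b, h b ∉ Z) ∧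
    EdgesPresent E ω A B (extendOn (B \ A) f h)

lemma exists_not_range_subset {β V : Type*} [Fintype β] [Fintype V] (F : Finset (β → V))
    (𝒯 : Finset (Finset V)) (t : ℕ) (h𝒯 : ∀ T ∈ 𝒯, T.card ≤ t)
    (h : 𝒯.card * t ^ Fintype.card β < F.card) : ∃ x ∈ F, ∀ T ∈ 𝒯, ∃ b, x b ∉ T := by
  by_contra! hno
  refine h.not_ge ?_
  have h1 : F ⊆ 𝒯.biUnion fun T => Fintype.piFinset fun _ : β => T := by
    intro x hx
    obtain ⟨T, hT, hxT⟩ := hno x hx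
    exact Finset.mem_biUnion.2 ⟨T, hT, Fintype.mem_piFinset.2 hxT⟩
  refine (Finset.card_le_card h1).trans (Finset.card_biUnion_le_card_mul _ _ _ fun T hT => ?_)
  rw [Fintype.card_piFinset, Finset.prod_const, Finset.card_univ]
  exact Nat.pow_le_pow_left (h𝒯 T hT) _

variable {k : Fin p → ℕ} {U V : Type*} [Fintype U] [Fintype V] [(Lang p k).Structure U]
  [(Lang p k).Structure V]

/-- If no small set has negative predimension, every configuration has many copies of `B`, and
there are only few dense sets, then every embedding extends freely. -/
lemma free_extension_of_many_copies (hU : SymmIrr k U) (hV : SymmIrr k V)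
    {α : Fin p → ℝ} (hα : ∀ i, 0 < α i) {η : ℝ} (hη : ∀ i, η ≤ α i)
    {t m L : ℕ} (hm : 0 < m)
    (hgap : ∀ X Y : Finset V, X ⊆ Y → (Y \ X).card ≤ t →
      predim α (edgesOf k V) Y < predim α (edgesOf k V) X →
        predim α (edgesOf k V) Y ≤ predim α (edgesOf k V) X - η)
    {A B C : Finset U} (hAB : A ⊆ B) (hAC : A ⊆ C) (ht : (B \ A).card + m ≤ t)
    (hL : (C.card : ℝ) < L * η)
    (hsparse : ∀ X : Finset V, X.card ≤ C.card + t * L → 0 ≤ predim α (edgesOf k V) X)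
    (κ : ℝ)
    (hlow : ∀ Z : Finset V, Z.card ≤ C.card + t * L →
      ((safeLowSets α (edgesOf k V) Z t
        (predim α (edgesOf k U) B - predim α (edgesOf k U) A - η)).card : ℝ) *
          t ^ (B \ A).card < κ)
    (hcopies : ∀ (Z : Finset V) (f : U → V), Z.card ≤ C.card + t * L → Set.InjOn f ↑A →
      A.image f ⊆ Z → κ ≤ (copies (edgesOf k U) (edgesOf k V) A B f Z).card)
    {f : U → V} (hf : IsEmbOn k C f)
    (hcl : (↑(C.image f) : Set V) = cl k α m (A.image f)) :
    ∃ g : U → V, IsEmbOn k B g ∧ (∀ a ∈ A, g a = f a) ∧ B.image g ∩ C.image f = A.image f ∧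
      FreelyJoined k (↑(A.image f) : Set V) ↑(C.image f) ↑(B.image g) ∧
      cl k α m (B.image g) = ↑(B.image g) ∪ (↑(C.image f) : Set V) := by
  obtain ⟨Z, hCZ, hZcard, hZ⟩ := exists_closed_superset α (fun i => (hα i).le) (edgesOf k V) hgap
    C.card L hL hsparse (C.image f) Finset.card_image_le
  have h1 := hcopies Z f hZcard (hf.1.mono (by exact_mod_cast hAC))
    ((Finset.image_subset_image hAC).trans hCZ)
  obtain ⟨h, hh, hT⟩ := exists_not_range_subset (copies (edgesOf k U) (edgesOf k V) A B f Z)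
    (safeLowSets α (edgesOf k V) Z t
        (predim α (edgesOf k U) B - predim α (edgesOf k U) A - η)) t
    (fun T hT => by
      simp only [safeLowSets, lowSets, Finset.mem_filter] at hT
      exact hT.1.2.2.1)
    (by
      rw [Fintype.card_coe]
      exact_mod_cast (hlow Z hZcard).trans_le h1)
  obtain ⟨hinj, hhZ, hpres⟩ := (Finset.mem_filter.1 hh).2
  have hfg : ∀ a ∈ A, extendOn (B \ A) f h a = f a := fun a ha =>
    extendOn_of_notMem f h fun h' => (Finset.mem_sdiff.1 h').2 ha
  obtain ⟨h2, h3, h4, h5⟩ := free_extension_of_no_dense hU hV hα hη hm hgap hAB hAC ht hf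
    (g := extendOn (B \ A) f h) hfg
    hcl hCZ (fun b hb => by rw [extendOn_of_mem f h hb]; exact hhZ _)
    (fun a ha b hb hab => by
      rw [extendOn_of_mem f h ha, extendOn_of_mem f h hb] at hab
      exact congrArg Subtype.val (hinj hab)) hpres
    (fun T hTZ hTt hT' => by
      by_contra! hle
      have hTlow : T ∈ safeLowSets α (edgesOf k V) Z t
          (predim α (edgesOf k U) B - predim α (edgesOf k U) A - η) := by
        simp only [safeLowSets, lowSets, Finset.mem_filter, Finset.mem_univ, true_and]
        refine ⟨⟨hTZ, hTt, hle⟩, fun Q hQ => hZ _ Finset.subset_union_right ?_⟩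
        refine (Finset.card_le_card fun x hx => ?_).trans hTt
        obtain ⟨hx1, hx2⟩ := Finset.mem_sdiff.1 hx
        exact hQ ((Finset.mem_union.1 hx1).resolve_right hx2)
      obtain ⟨b, hb⟩ := hT T hTlow
      refine hb (hT' (Finset.mem_image.2 ⟨b.1, b.2, ?_⟩))
      rw [extendOn_of_mem f h b.2])
  exact ⟨_, h2, hfg, h3, h4, h5⟩

end Copies

section CopiesProbability

/-- The probability of each potential edge. -/
noncomputable def edgeProb (k : Fin p → ℕ) (α γ : Fin p → ℝ) {V : Type*} [Fintype V]
    (c : Fin p × Finset V) : ℝ :=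
  if c.2.card = k c.1 then γ c.1 * (Fintype.card V : ℝ) ^ (-α c.1) else 0

lemma edgeProb_le {k : Fin p → ℕ} {α γ : Fin p → ℝ} (hγ : ∀ i, 0 < γ i ∧ γ i ≤ 1)
    {V : Type*} [Fintype V] (c : Fin p × Finset V) :
    edgeProb k α γ c ≤ (Fintype.card V : ℝ) ^ (-α c.1) := by
  rw [edgeProb]
  have h : 0 ≤ (Fintype.card V : ℝ) ^ (-α c.1) := Real.rpow_nonneg (Nat.cast_nonneg _) _
  split_ifs
  · exact mul_le_of_le_one_left h (hγ c.1).2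
  · exact h

lemma edgeProb_mem {k : Fin p → ℕ} {α γ : Fin p → ℝ} (hα : ∀ i, 0 < α i)
    (hγ : ∀ i, 0 < γ i ∧ γ i ≤ 1) {V : Type*} [Fintype V] (hn : 0 < Fintype.card V)
    (c : Fin p × Finset V) : 0 ≤ edgeProb k α γ c ∧ edgeProb k α γ c ≤ 1 := by
  refine ⟨?_, (edgeProb_le hγ c).trans ?_⟩
  · rw [edgeProb]
    split_ifs
    · exact mul_nonneg (hγ c.1).1.le (Real.rpow_nonneg (Nat.cast_nonneg _) _)
    · exact le_rfl
  · exact Real.rpow_le_one_of_one_le_of_nonpos (by exact_mod_cast hn) (by linarith [hα c.1])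

variable {U V : Type*} {A B : Finset U} {f : U → V} {Z : Finset V}

/-- Membership of a value of an extended map in `Z` detects membership in `A`. -/
lemma extendOn_mem_image (hfA : Set.InjOn f ↑A) (hfZ : A.image f ⊆ Z)
    {h h' : {u // u ∈ B \ A} → V} (hh : ∀ b, h b ∉ Z) (hh' : ∀ b, h' b ∉ Z) {S S' : Finset U}
    (hS' : S' ⊆ B)
    (hsub : S.image (extendOn (B \ A) f h) ⊆ S'.image (extendOn (B \ A) f h')) :
    (∀ u ∈ S, u ∈ A → u ∈ S') ∧ ∀ b : {u // u ∈ B \ A}, b.1 ∈ S → ∃ b', b'.1 ∈ S' ∧ h b = h' b' := by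
  refine ⟨fun u hu huA => ?_, fun b hb => ?_⟩
  · obtain ⟨u', hu', he⟩ := Finset.mem_image.1 (hsub (Finset.mem_image_of_mem _ hu))
    rw [extendOn_of_notMem f h fun h => (Finset.mem_sdiff.1 h).2 huA] at he
    by_cases hu'A : u' ∈ A
    · rw [extendOn_of_notMem f h' fun h => (Finset.mem_sdiff.1 h).2 hu'A] at he
      rwa [← hfA hu'A huA he]
    · rw [extendOn_of_mem f h' (Finset.mem_sdiff.2 ⟨hS' hu', hu'A⟩)] at he
      exact absurd (he ▸ hfZ (Finset.mem_image_of_mem f huA)) (hh' _)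
  · obtain ⟨u', hu', he⟩ := Finset.mem_image.1 (hsub (Finset.mem_image_of_mem _ hb))
    rw [extendOn_of_mem f h b.2] at he
    by_cases hu'A : u' ∈ A
    · rw [extendOn_of_notMem f h' fun h => (Finset.mem_sdiff.1 h).2 hu'A] at he
      exact absurd (he ▸ hfZ (Finset.mem_image_of_mem f hu'A)) (hh _)
    · rw [extendOn_of_mem f h' (Finset.mem_sdiff.2 ⟨hS' hu', hu'A⟩)] at he
      exact ⟨_, hu', he.symm⟩

lemma extendOn_injOn (hfA : Set.InjOn f ↑A) (hfZ : A.image f ⊆ Z)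
    {h : {u // u ∈ B \ A} → V} (hinj : Function.Injective h) (hh : ∀ b, h b ∉ Z) :
    Set.InjOn (extendOn (B \ A) f h) ↑B := by
  intro a ha b hb hab
  simp only [Finset.mem_coe] at ha hb
  obtain ⟨h1, h2⟩ := extendOn_mem_image hfA hfZ hh hh (S := {a}) (S' := {b})
    (by simpa using hb) (by simp [hab])
  by_cases haA : a ∈ A
  · simpa using h1 a (by simp) haA
  · obtain ⟨b', hb', he⟩ := h2 ⟨a, Finset.mem_sdiff.2 ⟨ha, haA⟩⟩ (by simp)
    rw [← Finset.mem_singleton.1 hb', ← hinj he]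

/-- The edges of `B` over `A`. -/
noncomputable def edgesOver (E : Finset (Fin p × Finset U)) (A B : Finset U) :
    Finset (Fin p × Finset U) :=
  E.filter fun c => c.2 ⊆ B ∧ ¬ c.2 ⊆ A

variable [Fintype V]

lemma expect_few_copies_le_of_embedding {k : Fin p → ℕ} {α γ : Fin p → ℝ} (hα : ∀ i, 0 < α i)
    (hγ : ∀ i, 0 < γ i ∧ γ i ≤ 1) {E : Finset (Fin p × Finset U)}
    (hE : ∀ c ∈ E, c.2.card = k c.1) (hn : 0 < Fintype.card V)
    (hfA : Set.InjOn f ↑A) (hfZ : A.image f ⊆ Z) {M q : ℕ} (hq : 0 < q)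
    (φ : Fin M × {u // u ∈ B \ A} × Fin q ↪ {v // v ∉ Z}) (hAB : A ⊆ B)
    (Λ : ℝ) (hΛ : 0 < Λ)
    (hD : ∀ D ⊆ B \ A, D.Nonempty → Λ ≤ (q : ℝ) ^ D.card *
      ∏ c ∈ edgesOver E A (A ∪ D), γ c.1 * (Fintype.card V : ℝ) ^ (-α c.1)) (κ : ℝ)
    (hκ : κ ≤ (q : ℝ) ^ (B \ A).card *
      ∏ c ∈ edgesOver E A B, γ c.1 * (Fintype.card V : ℝ) ^ (-α c.1)) :
    expect (edgeProb k α γ)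
        (fun T => if ((copies E T A B f Z).card : ℝ) < κ / 2 then (1 : ℝ) else 0) ≤
      (4 * 2 ^ (B \ A).card / Λ) ^ M := by
  set K := {c // c ∈ edgesOver E A B}
  have hK : ∀ c : K, c.1 ∈ E ∧ c.1.2 ⊆ B ∧ ¬ c.1.2 ⊆ A := fun c => Finset.mem_filter.1 c.2
  set hx : Fin M → ({u // u ∈ B \ A} → Fin q) → {u // u ∈ B \ A} → V :=
    fun j x b => (φ (j, b, x b)).1 with hhx
  have hxZ : ∀ j x b, hx j x b ∉ Z := fun j x b => (φ (j, b, x b)).2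
  have hxeq : ∀ {j j' x x' b b'}, hx j x b = hx j' x' b' → j = j' ∧ b = b' ∧ x b = x' b' := by
    intro j j' x x' b b' h
    have h1 := φ.injective (Subtype.ext h)
    simpa [Prod.ext_iff] using h1
  have hxinj : ∀ j x, Function.Injective (hx j x) := fun j x b b' h => (hxeq h).2.1
  set e : Fin M → ({u // u ∈ B \ A} → Fin q) → K → Fin p × Finset V :=
    fun j x c => (c.1.1, c.1.2.image (extendOn (B \ A) f (hx j x))) with he
  set supp : K → Finset {u // u ∈ B \ A} := fun c => Finset.univ.filter fun b => b.1 ∈ c.1.2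
    with hsupp
  have hsupp_ne : ∀ c, (supp c).Nonempty := fun c => by
    obtain ⟨u, hu, huA⟩ := Finset.not_subset.1 (hK c).2.2
    exact ⟨⟨u, Finset.mem_sdiff.2 ⟨(hK c).2.1 hu, huA⟩⟩, by simp [hsupp, hu]⟩
  have hsub : ∀ {j j' x x'} {c c' : K}, c.1.2.image (extendOn (B \ A) f (hx j x)) ⊆
      c'.1.2.image (extendOn (B \ A) f (hx j' x')) →
        j = j' ∧ c.1.2 ⊆ c'.1.2 ∧ ∀ b ∈ supp c, x b = x' b := by
    intro j j' x x' c c' h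
    obtain ⟨h1, h2⟩ := extendOn_mem_image hfA hfZ (hxZ j x) (hxZ j' x') (hK c').2.1 h
    have h3 : ∀ b ∈ supp c, j = j' ∧ b.1 ∈ c'.1.2 ∧ x b = x' b := by
      intro b hb
      obtain ⟨b', hb', hbb⟩ := h2 b (by simpa [hsupp] using hb)
      obtain ⟨rfl, rfl, h4⟩ := hxeq hbb
      exact ⟨rfl, hb', h4⟩
    obtain ⟨b, hb⟩ := hsupp_ne c
    refine ⟨(h3 b hb).1, fun u hu => ?_, fun b hb => (h3 b hb).2.2⟩
    by_cases huA : u ∈ A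
    · exact h1 u hu huA
    · exact (h3 ⟨u, Finset.mem_sdiff.2 ⟨(hK c).2.1 hu, huA⟩⟩ (by simp [hsupp, hu])).2.1
  have hee : ∀ j j' x x' c c', e j x c = e j' x' c' ↔
      j = j' ∧ c = c' ∧ ∀ b ∈ supp c, x b = x' b := by
    intro j j' x x' c c'
    constructor
    · intro h
      obtain ⟨hi, hS⟩ := Prod.mk.inj h
      obtain ⟨h1, h2, h3⟩ := hsub hS.subset
      obtain ⟨-, h4, -⟩ := hsub hS.symm.subset
      exact ⟨h1, Subtype.ext (Prod.ext hi (subset_antisymm h2 h4)), h3⟩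
    · rintro ⟨rfl, rfl, h⟩
      refine Prod.ext rfl (Finset.image_congr fun u hu => ?_)
      by_cases huB : u ∈ B \ A
      · rw [extendOn_of_mem f _ huB, extendOn_of_mem f _ huB]
        simp only [hhx]
        rw [h ⟨u, huB⟩ (by simpa [hsupp] using hu)]
      · rw [extendOn_of_notMem f _ huB, extendOn_of_notMem f _ huB]
  set ρ : K → ℝ := fun c => γ c.1.1 * (Fintype.card V : ℝ) ^ (-α c.1.1) with hρ
  have hn' : (0 : ℝ) < Fintype.card V := by exact_mod_cast hn
  have hρpos : ∀ c, 0 < ρ c := fun c => mul_pos (hγ _).1 (Real.rpow_pos_of_pos hn' _)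
  have hpe : ∀ j x c, edgeProb k α γ (e j x c) = ρ c := by
    intro j x c
    rw [edgeProb, if_pos]
    rw [Finset.card_image_of_injOn ((extendOn_injOn hfA hfZ (hxinj j x) (hxZ j x)).mono
      (by exact_mod_cast (hK c).2.1))]
    exact hE _ (hK c).1
  have hD' : ∀ D : Finset {u // u ∈ B \ A}, D.Nonempty →
      Λ ≤ (Fintype.card (Fin q) : ℝ) ^ D.card * ∏ c with supp c ⊆ D, ρ c := by
    intro D hDne
    refine (hD (D.map (Function.Embedding.subtype _)) (fun u hu => ?_) (by simpa using hDne)).trans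
      (le_of_eq ?_)
    · obtain ⟨b, -, rfl⟩ := Finset.mem_map.1 hu
      exact b.2
    · rw [Finset.card_map, Fintype.card_fin]
      congr 1
      symm
      refine Finset.prod_bij (fun c _ => c.1) ?_ ?_ ?_ ?_
      · intro c hc
        refine Finset.mem_filter.2 ⟨(hK c).1, fun u hu => ?_, (hK c).2.2⟩
        by_cases huA : u ∈ A
        · exact Finset.mem_union_left _ huA
        · have huB := Finset.mem_sdiff.2 ⟨(hK c).2.1 hu, huA⟩
          exact Finset.mem_union_right _ (Finset.mem_map.2 ⟨⟨u, huB⟩,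
            (Finset.mem_filter.1 hc).2 (by simpa [hsupp] using hu), rfl⟩)
      · intro c _ c' _ h
        exact Subtype.ext h
      · intro c hc
        obtain ⟨h1, h2, h3⟩ := Finset.mem_filter.1 hc
        have h4 : ∀ u ∈ c.2, u ∉ A → ∃ hu : u ∈ B \ A, (⟨u, hu⟩ : {u // u ∈ B \ A}) ∈ D := by
          intro u hu huA
          obtain ⟨b, hb, rfl⟩ := Finset.mem_map.1 ((Finset.mem_union.1 (h2 hu)).resolve_left huA)
          exact ⟨b.2, hb⟩
        refine ⟨⟨c, Finset.mem_filter.2 ⟨h1, fun u hu => ?_, h3⟩⟩, ?_, rfl⟩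
        · by_cases huA : u ∈ A
          · exact hAB huA
          · exact (Finset.mem_sdiff.1 (h4 u hu huA).1).1
        · refine Finset.mem_filter.2 ⟨Finset.mem_univ _, fun b hb => ?_⟩
          exact (h4 b.1 (by simpa [hsupp] using hb) (Finset.mem_sdiff.1 b.2).2).2
      · intro c _
        rfl
  have hfin := expect_all_below_half_le (J := Fin M) (Q := Fin q) (edgeProb k α γ)
    (edgeProb_mem hα hγ hn) e supp hsupp_ne hee ρ hρpos hpe Λ hΛ (by simpa using hq)
    (fun D hD => by convert hD' D hD) _ rfl
  rw [Fintype.card_fin, Fintype.card_fin, Fintype.card_coe] at hfin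
  refine le_trans (expect_mono (edgeProb_mem hα hγ hn) fun T => ?_) hfin
  have hprod : ∏ c, ρ c = ∏ c ∈ edgesOver E A B, γ c.1 * (Fintype.card V : ℝ) ^ (-α c.1) :=
    Finset.prod_coe_sort (edgesOver E A B) fun c => γ c.1 * (Fintype.card V : ℝ) ^ (-α c.1)
  split_ifs with h1 h2 <;> try norm_num
  refine h2 fun j => ?_
  rw [hprod]
  refine lt_of_le_of_lt ?_ (h1.trans_le (by linarith))
  refine le_trans (b := (((Finset.univ : Finset ({u // u ∈ B \ A} → Fin q)).filter fun x =>
    ∀ c, e j x c ∈ T).card : ℝ)) ?_ (Nat.cast_le.2 ?_)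
  · rw [Finset.card_filter, Nat.cast_sum]
    have huniv : ∀ (F : ({u // u ∈ B \ A} → Fin q) → ℝ) (i i' : Fintype ({u // u ∈ B \ A} → Fin q)),
        ∑ x ∈ @Finset.univ _ i, F x = ∑ x ∈ @Finset.univ _ i', F x := fun F i i' => by
      rw [Subsingleton.elim i i']
    refine (huniv _ _ _).trans_le (Finset.sum_le_sum fun x _ => ?_)
    split_ifs with h3 h4 h4
    · simp
    · exact absurd (fun c => h3 (by simp)) h4
    · simp
    · simp
  refine Finset.card_le_card_of_injOn (fun x => hx j x) ?_ ?_
  · intro x hx'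
    have hx'' := (Finset.mem_filter.1 hx').2
    refine Finset.mem_filter.2 ⟨Finset.mem_univ _, hxinj j x, hxZ j x, fun c hc h3 h4 => ?_⟩
    exact hx'' ⟨c, Finset.mem_filter.2 ⟨hc, h3, h4⟩⟩
  · intro x _ x' _ h
    funext b
    exact (hxeq (congrFun h b)).2.2

end CopiesProbability

section FewCopies

lemma prod_edgesOver_ge {α γ : Fin p → ℝ} (hγ : ∀ i, 0 < γ i ∧ γ i ≤ 1) {U : Type*}
    {E : Finset (Fin p × Finset U)} {A B D : Finset U} (hAB : A ⊆ B) (hDB : D ⊆ B \ A)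
    {x c q : ℝ} (hx : 0 < x) (hc : 0 < c) (hc1 : c ≤ 1) (hq : c * x ≤ q) :
    c ^ (B \ A).card * (∏ c ∈ edgesOver E A B, γ c.1) *
        x ^ (predim α E (A ∪ D) - predim α E A) ≤
      q ^ D.card * ∏ c ∈ edgesOver E A (A ∪ D), γ c.1 * x ^ (-α c.1) := by
  have hD : (A ∪ D) \ A = D := by
    rw [Finset.union_sdiff_left]
    exact Finset.sdiff_eq_self_of_disjoint (Finset.disjoint_of_subset_left hDB Finset.sdiff_disjoint)
  rw [predim_sub α E Finset.subset_union_left, hD, sub_eq_add_neg, Real.rpow_add hx,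
    Real.rpow_natCast, ← Finset.sum_neg_distrib, Real.rpow_sum_of_pos hx, Finset.prod_mul_distrib]
  have hsub : edgesOver E A (A ∪ D) ⊆ edgesOver E A B := by
    intro e he
    obtain ⟨h1, h2, h3⟩ := Finset.mem_filter.1 he
    exact Finset.mem_filter.2 ⟨h1,
      h2.trans (Finset.union_subset hAB (hDB.trans Finset.sdiff_subset)), h3⟩
  have h1 : ∏ c ∈ edgesOver E A B, γ c.1 ≤ ∏ c ∈ edgesOver E A (A ∪ D), γ c.1 := by
    rw [← Finset.prod_sdiff hsub]
    exact mul_le_of_le_one_left (Finset.prod_nonneg fun c _ => (hγ c.1).1.le)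
      (Finset.prod_le_one (fun c _ => (hγ c.1).1.le) fun c _ => (hγ c.1).2)
  have h2 : c ^ (B \ A).card * x ^ D.card ≤ q ^ D.card :=
    calc c ^ (B \ A).card * x ^ D.card ≤ c ^ D.card * x ^ D.card := by
          gcongr ?_ * _
          exact pow_le_pow_of_le_one hc.le hc1 (Finset.card_le_card hDB)
      _ = (c * x) ^ D.card := (mul_pow _ _ _).symm
      _ ≤ q ^ D.card := by gcongr
  have h3 : 0 ≤ ∏ c ∈ edgesOver E A (A ∪ D), x ^ (-α c.1) :=
    Finset.prod_nonneg fun c _ => Real.rpow_nonneg hx.le _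
  have h4 : 0 ≤ ∏ c ∈ edgesOver E A B, γ c.1 := Finset.prod_nonneg fun c _ => (hγ c.1).1.le
  have h5 : 0 ≤ q ^ D.card := pow_nonneg ((mul_pos hc hx).le.trans hq) _
  calc _ = (c ^ (B \ A).card * x ^ D.card) * ((∏ c ∈ edgesOver E A B, γ c.1) *
        ∏ c ∈ edgesOver E A (A ∪ D), x ^ (-α c.1)) := by
        simp only [edgesOver]
        ring
    _ ≤ _ := by gcongr

/-- With high probability there are many copies of `B` over a given copy of `A`. -/
lemma expect_few_copies_le {k : Fin p → ℕ} {α γ : Fin p → ℝ} (hα : ∀ i, 0 < α i)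
    (hγ : ∀ i, 0 < γ i ∧ γ i ≤ 1) {U : Type*} {E : Finset (Fin p × Finset U)}
    (hE : ∀ c ∈ E, c.2.card = k c.1) {A B : Finset U} (hAB : A ⊆ B) (hne : A ≠ B) {ε : ℝ}
    (hε : ∀ D ⊆ B \ A, D.Nonempty → ε ≤ predim α E (A ∪ D) - predim α E A) (N : ℕ) {M : ℕ}
    (hM : 0 < M) :
    ∃ κ > 0, ∃ C : ℝ, ∃ n₀ : ℕ, ∀ {V : Type} [Fintype V], n₀ ≤ Fintype.card V →
      ∀ (Z : Finset V) (f : U → V), Z.card ≤ N → Set.InjOn f ↑A → A.image f ⊆ Z →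
        expect (edgeProb k α γ) (fun T => if ((copies E T A B f Z).card : ℝ) <
            κ * (Fintype.card V : ℝ) ^ (predim α E B - predim α E A) then (1 : ℝ) else 0) ≤
          C * (Fintype.card V : ℝ) ^ (-(ε * M)) := by
  set b := (B \ A).card with hb
  have hbpos : 0 < b := by
    rw [hb, Finset.card_pos, Finset.sdiff_nonempty]
    exact fun h => hne (subset_antisymm hAB h)
  set G := ∏ c ∈ edgesOver E A B, γ c.1 with hG
  have hGpos : 0 < G := Finset.prod_pos fun c _ => (hγ c.1).1
  have hMb : 0 < M * b := Nat.mul_pos hM hbpos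
  have hMb' : (1 : ℝ) ≤ M * b := by exact_mod_cast hMb
  set c₀ : ℝ := 1 / (2 * (M * b)) with hc₀
  have hc₀pos : 0 < c₀ := by positivity
  have hc₀1 : c₀ ≤ 1 := by
    rw [hc₀, div_le_one (by positivity)]
    linarith
  refine ⟨c₀ ^ b * G / 2, by positivity, (4 * 2 ^ b / (c₀ ^ b * G)) ^ M, 2 * N + 2 * (M * b),
    fun {V} _ hn Z f hZ hfA hfZ => ?_⟩
  have hn0 : 0 < Fintype.card V := by omega
  set n := Fintype.card V with hn_def
  have hn1 : (1 : ℝ) ≤ n := by exact_mod_cast hn0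
  have hnpos : (0 : ℝ) < n := by linarith
  set q := (n - N) / (M * b) with hq
  have hq1 : c₀ * n ≤ q := by
    have h1 : n - N < M * b * (q + 1) := Nat.lt_mul_div_succ _ hMb
    have h2 : n ≤ N + M * b * (q + 1) := by omega
    have h3 : (n : ℝ) ≤ N + M * b * (q + 1) := by exact_mod_cast h2
    have h4 : (2 * N + 2 * (M * b) : ℝ) ≤ n := by exact_mod_cast hn
    rw [hc₀, div_mul_eq_mul_div, one_mul, div_le_iff₀ (by positivity)]
    nlinarith
  have hqpos : 0 < q := by
    have : (0 : ℝ) < q := lt_of_lt_of_le (by positivity) hq1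
    exact_mod_cast this
  obtain ⟨φ⟩ : Nonempty (Fin M × {u // u ∈ B \ A} × Fin q ↪ {v // v ∉ Z}) := by
    refine Function.Embedding.nonempty_of_card_le ?_
    have h1 : Fintype.card {v // v ∉ Z} = n - Z.card := by
      rw [Fintype.card_subtype_compl, Fintype.card_coe]
    rw [h1, Fintype.card_prod, Fintype.card_prod, Fintype.card_fin, Fintype.card_fin,
      Fintype.card_coe, ← mul_assoc]
    refine (Nat.mul_div_le _ _).trans (by omega)
  have hmain := expect_few_copies_le_of_embedding (k := k) hα hγ hE hn0 hfA hfZ hqpos φ hAB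
    (c₀ ^ b * G * (n : ℝ) ^ ε) (by positivity)
    (fun D hD hDne => by
      refine le_trans ?_ (prod_edgesOver_ge hγ hAB hD hnpos hc₀pos hc₀1 hq1)
      gcongr
      exact hε D hD hDne)
    (c₀ ^ b * G * (n : ℝ) ^ (predim α E B - predim α E A))
    (by
      have := prod_edgesOver_ge (α := α) (E := E) hγ hAB subset_rfl hnpos hc₀pos hc₀1 hq1
      rwa [Finset.union_sdiff_of_subset hAB] at this)
  convert hmain using 1
  · congr 1
    funext T
    rw [div_mul_eq_mul_div]
  · rw [← div_div (4 * 2 ^ b) (c₀ ^ b * G) ((n : ℝ) ^ ε), div_pow _ ((n : ℝ) ^ ε),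
      ← Real.rpow_mul_natCast hnpos.le, Real.rpow_neg hnpos.le, div_eq_mul_inv _ ((n : ℝ) ^ _)]

end FewCopies

section BadEvents

variable {k : Fin p → ℕ} {α γ : Fin p → ℝ}

lemma card_filter_card_le {V : Type*} [Fintype V] (hn : 0 < Fintype.card V) (N : ℕ) :
    (((Finset.univ : Finset (Finset V)).filter fun Z => Z.card ≤ N).card : ℝ) ≤
      (N + 1) * (Fintype.card V : ℝ) ^ N := by
  have h1 : ((Finset.univ : Finset (Finset V)).filter fun Z => Z.card ≤ N) ⊆
      (Finset.range (N + 1)).biUnion fun j => Finset.powersetCard j Finset.univ := by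
    intro Z hZ
    have h := (Finset.mem_filter.1 hZ).2
    exact Finset.mem_biUnion.2 ⟨Z.card, by simpa [Nat.lt_succ_iff] using h, by simp⟩
  have h2 : ((Finset.univ : Finset (Finset V)).filter fun Z => Z.card ≤ N).card ≤
      (N + 1) * Fintype.card V ^ N := by
    refine (Finset.card_le_card h1).trans ((Finset.card_biUnion_le_card_mul _ _
      (Fintype.card V ^ N) fun j hj => ?_).trans_eq (by rw [Finset.card_range]))
    rw [Finset.card_powersetCard, Finset.card_univ]
    exact (Nat.choose_le_pow _ _).trans
      (Nat.pow_le_pow_right hn (Nat.lt_succ_iff.1 (Finset.mem_range.1 hj)))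
  exact_mod_cast h2

lemma expect_exists_neg_predim_le (hα : ∀ i, 0 < α i) (hγ : ∀ i, 0 < γ i ∧ γ i ≤ 1) (N : ℕ) :
    ∃ η : ℝ, 0 < η ∧ ∃ C : ℝ, ∀ {V : Type} [Fintype V], 0 < Fintype.card V →
      expect (edgeProb k α γ) (fun T : Finset (Fin p × Finset V) =>
          if ∃ X : Finset V, X.card ≤ N ∧ predim α T X < 0 then (1 : ℝ) else 0) ≤
        C * (Fintype.card V : ℝ) ^ (-η) := by
  obtain ⟨η, hη, hηα, hgap⟩ := exists_predim_gap α hα N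
  refine ⟨η, hη, p + (N + 1) * 2 ^ (p * 2 ^ (0 + N)), fun {V} _ hn => ?_⟩
  have hn1 : (1 : ℝ) ≤ Fintype.card V := by exact_mod_cast hn
  have hle : expect (edgeProb k α γ) (fun T : Finset (Fin p × Finset V) =>
      if ∃ X : Finset V, X.card ≤ N ∧ predim α T X < 0 then (1 : ℝ) else 0) ≤
      expect (edgeProb k α γ) (fun T : Finset (Fin p × Finset V) =>
        (∑ i : Fin p, if {(i, (∅ : Finset V))} ⊆ T then (1 : ℝ) else 0) +
          ((lowSets α T ∅ N (-η)).card : ℝ)) := by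
    refine expect_mono (edgeProb_mem hα hγ hn) fun T => ?_
    have hs : ∀ i : Fin p, (0 : ℝ) ≤ if {(i, (∅ : Finset V))} ⊆ T then (1 : ℝ) else 0 := fun i => by
      split_ifs <;> norm_num
    have hs' := Finset.sum_nonneg fun i (_ : i ∈ (Finset.univ : Finset (Fin p))) => hs i
    split_ifs with h
    · by_cases he : ∃ i : Fin p, (i, (∅ : Finset V)) ∈ T
      · obtain ⟨i, hi⟩ := he
        have h1 := Finset.single_le_sum (fun i _ => hs i) (Finset.mem_univ i)
        rw [if_pos (Finset.singleton_subset_iff.2 hi)] at h1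
        have h2 : (0 : ℝ) ≤ ((lowSets α T ∅ N (-η)).card : ℝ) := Nat.cast_nonneg _
        linarith
      · obtain ⟨X, hX, hneg⟩ := h
        have h0 : predim α T ∅ = 0 := by
          rw [predim, edgeWeight, Finset.filter_false_of_mem]
          · simp
          · intro c hc hc'
            rw [Finset.subset_empty] at hc'
            exact he ⟨c.1, by rw [← hc']; exact hc⟩
        have h1 := hgap T ∅ X (Finset.empty_subset _) (by simpa using hX) (by rwa [h0])
        have h2 : X ∈ lowSets α T ∅ N (-η) := by
          simp only [lowSets, Finset.mem_filter, Finset.mem_univ, true_and, Finset.union_empty]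
          exact ⟨Finset.disjoint_empty_right _, hX, by linarith⟩
        have h3 : (1 : ℝ) ≤ ((lowSets α T ∅ N (-η)).card : ℝ) := by
          exact_mod_cast Finset.card_pos.2 ⟨X, h2⟩
        linarith
    · positivity
  refine hle.trans ?_
  rw [expect_add, expect_sum, add_mul]
  refine add_le_add ?_ (expect_card_lowSets_le α _ (edgeProb_mem hα hγ hn) hn (edgeProb_le hγ)
    0 N (-η) ∅ (by simp))
  refine (Finset.sum_le_card_nsmul _ _ ((Fintype.card V : ℝ) ^ (-η)) fun i _ => ?_).trans_eq
    (by simp)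
  rw [expect_subset, Finset.prod_singleton]
  exact (edgeProb_le hγ _).trans (Real.rpow_le_rpow_of_exponent_le hn1 (neg_le_neg (hηα i)))

/-- Union bound. -/
lemma expect_exists_le {I : Type*} [Fintype I] {pr : I → ℝ} (h : ∀ c, 0 ≤ pr c ∧ pr c ≤ 1)
    {κ : Type*} (s : Finset κ) (P : κ → Finset I → Prop) {r : ℝ}
    (hr : ∀ a ∈ s, expect pr (fun T => if P a T then 1 else 0) ≤ r) :
    expect pr (fun T => if ∃ a ∈ s, P a T then 1 else 0) ≤ s.card * r := by
  rw [← nsmul_eq_mul]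
  refine le_trans ?_ (Finset.sum_le_card_nsmul _ _ r hr)
  rw [← expect_sum]
  refine expect_mono h fun T => ?_
  have hs : ∀ a, (0 : ℝ) ≤ if P a T then (1 : ℝ) else 0 := fun a => by split_ifs <;> norm_num
  split_ifs with h
  · obtain ⟨a, ha, hP⟩ := h
    refine le_trans ?_ (Finset.single_le_sum (fun a _ => hs a) ha)
    rw [if_pos hP]
  · exact Finset.sum_nonneg fun a _ => hs a

lemma expect_exists_many_safeLowSets_le (hα : ∀ i, 0 < α i) (hγ : ∀ i, 0 < γ i ∧ γ i ≤ 1)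
    (N t : ℕ) (d : ℝ) {η κ : ℝ} (hη : 0 < η) (hκ : 0 < κ) :
    ∃ C : ℝ, ∀ {V : Type} [Fintype V], 0 < Fintype.card V →
      expect (edgeProb k α γ) (fun T : Finset (Fin p × Finset V) =>
          if ∃ Z : Finset V, Z.card ≤ N ∧ κ * (Fintype.card V : ℝ) ^ (d + η) ≤
            (safeLowSets α T Z t d).card then (1 : ℝ) else 0) ≤
        C * (Fintype.card V : ℝ) ^ (-1 : ℝ) := by
  obtain ⟨r, hr⟩ := exists_nat_ge ((N + 1) / η)
  rw [div_le_iff₀ hη] at hr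
  refine ⟨(N + 1) * (((2 ^ (r * t)) ^ r * ((r * t + 1) * 2 ^ (p * 2 ^ (N + r * t)))) *
    (1 / κ) ^ r), fun {V} _ hn => ?_⟩
  have hn1 : (1 : ℝ) ≤ Fintype.card V := by exact_mod_cast hn
  have hn0 : (0 : ℝ) < Fintype.card V := by linarith
  have h1 := expect_exists_le (edgeProb_mem (k := k) hα hγ hn)
    ((Finset.univ : Finset (Finset V)).filter fun Z => Z.card ≤ N)
    (fun Z T => κ * (Fintype.card V : ℝ) ^ (d + η) ≤ (safeLowSets α T Z t d).card)
    (fun Z hZ => expect_many_safeLowSets_le α (fun i => (hα i).le) _ (edgeProb_mem hα hγ hn) hn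
      (edgeProb_le hγ) N t r d Z (Finset.mem_filter.1 hZ).2 (κ * (Fintype.card V : ℝ) ^ (d + η))
      (by positivity))
  simp only [Finset.mem_filter, Finset.mem_univ, true_and] at h1
  refine h1.trans ((mul_le_mul_of_nonneg_right (card_filter_card_le hn N)
    (by positivity)).trans ?_)
  set n := (Fintype.card V : ℝ)
  have h2 : (n ^ d / (κ * n ^ (d + η))) ^ r = (1 / κ) ^ r * n ^ (-(r * η)) := by
    rw [show n ^ d / (κ * n ^ (d + η)) = 1 / κ * n ^ (-η) by
      rw [Real.rpow_add hn0, Real.rpow_neg hn0.le]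
      field_simp, mul_pow, ← Real.rpow_mul_natCast hn0.le]
    congr 2
    ring
  have h3 : n ^ N * n ^ (-(r * η)) ≤ n ^ (-1 : ℝ) := by
    rw [← Real.rpow_natCast n N, ← Real.rpow_add hn0]
    exact Real.rpow_le_rpow_of_exponent_le hn1 (by linarith)
  rw [h2]
  calc _ = (N + 1) * (((2 ^ (r * t)) ^ r * ((r * t + 1) * 2 ^ (p * 2 ^ (N + r * t)))) *
        (1 / κ) ^ r) * (n ^ N * n ^ (-(r * η))) := by ring
    _ ≤ _ := by gcongr

lemma expect_exists_few_copies_le (hα : ∀ i, 0 < α i) (hγ : ∀ i, 0 < γ i ∧ γ i ≤ 1)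
    {U : Type} [Fintype U] {E : Finset (Fin p × Finset U)} (hE : ∀ c ∈ E, c.2.card = k c.1)
    {A B : Finset U} (hAB : A ⊆ B) (hne : A ≠ B)
    (hs : ∀ D ⊆ B \ A, D.Nonempty → 0 < predim α E (A ∪ D) - predim α E A) (N : ℕ) :
    ∃ κ > 0, ∃ C : ℝ, ∃ n₀ : ℕ, ∀ {V : Type} [Fintype V], n₀ ≤ Fintype.card V →
      0 < Fintype.card V →
      expect (edgeProb k α γ) (fun T : Finset (Fin p × Finset V) =>
          if ∃ (Z : Finset V) (f : U → V), Z.card ≤ N ∧ Set.InjOn f ↑A ∧ A.image f ⊆ Z ∧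
            ((copies E T A B f Z).card : ℝ) <
              κ * (Fintype.card V : ℝ) ^ (predim α E B - predim α E A) then (1 : ℝ) else 0) ≤
        C * (Fintype.card V : ℝ) ^ (-1 : ℝ) := by
  obtain ⟨ε, hε, hεD⟩ : ∃ ε > 0, ∀ D ⊆ B \ A, D.Nonempty →
      ε ≤ predim α E (A ∪ D) - predim α E A := by
    have hfin : ((B \ A).powerset.filter fun D => D.Nonempty).Nonempty :=
      ⟨B \ A, by
        simpa [Finset.sdiff_nonempty] using fun h => hne (subset_antisymm hAB h)⟩
    obtain ⟨D₀, hD₀, hmin⟩ := Finset.exists_min_image _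
      (fun D => predim α E (A ∪ D) - predim α E A) hfin
    simp only [Finset.mem_filter, Finset.mem_powerset] at hD₀ hmin
    exact ⟨_, hs D₀ hD₀.1 hD₀.2, fun D hD hD' => hmin D ⟨hD, hD'⟩⟩
  obtain ⟨M, hM⟩ := exists_nat_ge ((N + Fintype.card U + 1) / ε)
  have hMpos : 0 < M := by
    have : (0 : ℝ) < M := lt_of_lt_of_le (by positivity) hM
    exact_mod_cast this
  rw [div_le_iff₀ hε] at hM
  obtain ⟨κ, hκ, C, n₀, hC⟩ := expect_few_copies_le (k := k) hα hγ hE hAB hne hεD N hMpos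
  refine ⟨κ, hκ, (N + 1) * max C 0, n₀, fun {V} _ hn₀ hn => ?_⟩
  have hn1 : (1 : ℝ) ≤ Fintype.card V := by exact_mod_cast hn
  have hn0 : (0 : ℝ) < Fintype.card V := by linarith
  have h1 := expect_exists_le (edgeProb_mem (k := k) hα hγ hn)
    (((Finset.univ : Finset (Finset V)).filter fun Z => Z.card ≤ N) ×ˢ
      (Finset.univ : Finset (U → V)))
    (fun x T => Set.InjOn x.2 ↑A ∧ A.image x.2 ⊆ x.1 ∧ ((copies E T A B x.2 x.1).card : ℝ) <
      κ * (Fintype.card V : ℝ) ^ (predim α E B - predim α E A))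
    (r := max C 0 * (Fintype.card V : ℝ) ^ (-(ε * M)))
    (fun x hx => by
      have hZ := (Finset.mem_filter.1 (Finset.mem_product.1 hx).1).2
      by_cases h : Set.InjOn x.2 ↑A ∧ A.image x.2 ⊆ x.1
      · refine le_trans (le_of_eq ?_) ((hC hn₀ x.1 x.2 hZ h.1 h.2).trans ?_)
        · simp only [h.1, h.2, true_and]
        · gcongr
          exact le_max_left _ _
      · refine (Finset.sum_eq_zero fun T _ => ?_).trans_le (by positivity)
        exact mul_eq_zero_of_right _ (if_neg fun h' => h ⟨h'.1, h'.2.1⟩))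
  refine le_trans (expect_mono (edgeProb_mem hα hγ hn) fun T => ?_) (h1.trans ?_)
  · split_ifs with h2 h3 <;> try norm_num
    obtain ⟨Z, f, hZ, h⟩ := h2
    exact h3 ⟨(Z, f), by simpa using hZ, h⟩
  · rw [Finset.card_product, Finset.card_univ, Fintype.card_fun, Nat.cast_mul, Nat.cast_pow]
    refine (mul_le_mul_of_nonneg_right (mul_le_mul_of_nonneg_right (card_filter_card_le hn N)
      (by positivity)) (by positivity)).trans ?_
    set n := (Fintype.card V : ℝ)
    have h3 : n ^ N * n ^ Fintype.card U * n ^ (-(ε * M)) ≤ n ^ (-1 : ℝ) := by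
      rw [← Real.rpow_natCast n N, ← Real.rpow_natCast n, ← Real.rpow_add hn0, ← Real.rpow_add hn0]
      exact Real.rpow_le_rpow_of_exponent_le hn1 (by linarith)
    calc _ = (N + 1) * max C 0 * (n ^ N * n ^ Fintype.card U * n ^ (-(ε * M))) := by ring
      _ ≤ _ := by gcongr

end BadEvents

section RandomStructure

variable {k : Fin p → ℕ} {α γ : Fin p → ℝ}

lemma expect_not_free_extension_le (hα : ∀ i, 0 < α i) (hγ : ∀ i, 0 < γ i ∧ γ i ≤ 1)
    {U : Type} [Fintype U] [(Lang p k).Structure U] (hU : SymmIrr k U)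
    {A B C : Finset U} (hAB : A ⊆ B) (hne : A ≠ B) (hAC : A ⊆ C)
    (hs : ∀ B₁ : Finset U, A ⊂ B₁ → B₁ ⊆ B → 0 < delta k α B₁ - delta k α A)
    {m : ℕ} (hm : 0 < m) :
    ∃ η : ℝ, 0 < η ∧ ∃ K : ℝ, ∃ n₀ : ℕ, ∀ {V : Type} [Fintype V], n₀ ≤ Fintype.card V →
      0 < Fintype.card V →
      expect (edgeProb k α γ) (fun T : Finset (Fin p × Finset V) =>
        if ∀ _ : (Lang p k).Structure V, SymmIrr k V → edgesOf k V = T →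
            ∀ f : U → V, IsEmbOn k C f → (↑(C.image f) : Set V) = cl k α m (A.image f) →
              ∃ g : U → V, IsEmbOn k B g ∧ (∀ a ∈ A, g a = f a) ∧
                B.image g ∩ C.image f = A.image f ∧
                FreelyJoined k (↑(A.image f) : Set V) ↑(C.image f) ↑(B.image g) ∧
                cl k α m (B.image g) = ↑(B.image g) ∪ (↑(C.image f) : Set V)
          then (0 : ℝ) else 1) ≤ K * (Fintype.card V : ℝ) ^ (-η) := by
  set t := (B \ A).card + m with ht
  obtain ⟨η, hη, hηα, hgap⟩ := exists_predim_gap α hα t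
  obtain ⟨L, hL⟩ := exists_nat_gt (C.card / η)
  rw [div_lt_iff₀ hη] at hL
  set N := C.card + t * L with hN
  have hs' : ∀ D ⊆ B \ A, D.Nonempty →
      0 < predim α (edgesOf k U) (A ∪ D) - predim α (edgesOf k U) A := by
    intro D hD hDne
    rw [← delta_eq_predim, ← delta_eq_predim]
    refine hs _ ?_ (Finset.union_subset hAB (hD.trans Finset.sdiff_subset))
    refine Finset.ssubset_iff_subset_ne.2 ⟨Finset.subset_union_left, fun h => ?_⟩
    obtain ⟨u, hu⟩ := hDne
    exact (Finset.mem_sdiff.1 (hD hu)).2 (h ▸ Finset.mem_union_right _ hu)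
  obtain ⟨η', hη', K₁, h₁⟩ := expect_exists_neg_predim_le (k := k) hα hγ N
  obtain ⟨κ, hκ, K₂, n₀, h₂⟩ := expect_exists_few_copies_le (k := k) (E := edgesOf k U) hα hγ
    (fun c hc => (mem_edgesOf.1 hc).card_eq) hAB hne hs' N
  set δ := predim α (edgesOf k U) B - predim α (edgesOf k U) A with hδ
  have htpos : (0 : ℝ) < (t : ℝ) ^ (B \ A).card := by
    have : 0 < t := by omega
    positivity
  obtain ⟨K₃, h₃⟩ := expect_exists_many_safeLowSets_le (k := k) hα hγ N t (δ - η) hη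
    (div_pos hκ htpos)
  refine ⟨min η' 1, by positivity, max K₁ 0 + max K₂ 0 + max K₃ 0, n₀, fun {V} _ hn₀ hn => ?_⟩
  have hn1 : (1 : ℝ) ≤ Fintype.card V := by exact_mod_cast hn
  have hrate : ∀ K η'' : ℝ, min η' 1 ≤ η'' → K * (Fintype.card V : ℝ) ^ (-η'') ≤
      max K 0 * (Fintype.card V : ℝ) ^ (-(min η' 1)) := by
    intro K η'' h
    refine (mul_le_mul_of_nonneg_right (le_max_left K 0) (by positivity)).trans ?_
    exact mul_le_mul_of_nonneg_left
      (Real.rpow_le_rpow_of_exponent_le hn1 (neg_le_neg h)) (le_max_right _ _)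
  rw [add_mul, add_mul]
  refine le_trans ?_ (add_le_add (add_le_add ((h₁ hn).trans (hrate _ _ (min_le_left _ _)))
    ((h₂ hn₀ hn).trans (hrate _ _ (min_le_right _ _))))
    ((h₃ hn).trans (hrate _ _ (min_le_right _ _))))
  rw [← expect_add, ← expect_add]
  refine expect_mono (edgeProb_mem hα hγ hn) fun T => ?_
  have hind : ∀ P : Prop, (0 : ℝ) ≤ if P then 1 else 0 := fun P => by split_ifs <;> norm_num
  by_cases hb₁ : ∃ X : Finset V, X.card ≤ N ∧ predim α T X < 0
  · rw [if_pos hb₁]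
    have := hind (∃ (Z : Finset V) (f : U → V), Z.card ≤ N ∧ Set.InjOn f ↑A ∧ A.image f ⊆ Z ∧
      ((copies (edgesOf k U) T A B f Z).card : ℝ) < κ * (Fintype.card V : ℝ) ^ δ)
    have := hind (∃ Z : Finset V, Z.card ≤ N ∧ κ / (t : ℝ) ^ (B \ A).card *
      (Fintype.card V : ℝ) ^ (δ - η + η) ≤ (safeLowSets α T Z t (δ - η)).card)
    split_ifs at * <;> linarith
  by_cases hb₂ : ∃ (Z : Finset V) (f : U → V), Z.card ≤ N ∧ Set.InjOn f ↑A ∧ A.image f ⊆ Z ∧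
      ((copies (edgesOf k U) T A B f Z).card : ℝ) < κ * (Fintype.card V : ℝ) ^ δ
  · rw [if_neg hb₁, if_pos hb₂]
    have := hind (∃ Z : Finset V, Z.card ≤ N ∧ κ / (t : ℝ) ^ (B \ A).card *
      (Fintype.card V : ℝ) ^ (δ - η + η) ≤ (safeLowSets α T Z t (δ - η)).card)
    split_ifs at * <;> linarith
  by_cases hb₃ : ∃ Z : Finset V, Z.card ≤ N ∧ κ / (t : ℝ) ^ (B \ A).card *
      (Fintype.card V : ℝ) ^ (δ - η + η) ≤ (safeLowSets α T Z t (δ - η)).card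
  · rw [if_neg hb₁, if_neg hb₂, if_pos hb₃]
    split_ifs <;> linarith
  rw [if_neg hb₁, if_neg hb₂, if_neg hb₃, if_pos]
  · norm_num
  push Not at hb₁ hb₂ hb₃
  rintro _ hV rfl f hf hcl
  refine free_extension_of_many_copies hU hV hα hηα hm (hgap (edgesOf k V)) hAB hAC le_rfl hL hb₁
    (κ * (Fintype.card V : ℝ) ^ δ) (fun Z hZ => ?_) hb₂ hf hcl
  have h := hb₃ Z hZ
  rw [sub_add_cancel, div_mul_eq_mul_div, lt_div_iff₀ htpos] at h
  exact h

/-- The configuration whose relations are the members of `T`. -/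
noncomputable def configOf {n : ℕ} (T : Finset (Fin p × Finset (Fin n))) : Config p n :=
  fun i S => decide ((i, S) ∈ T)

lemma symmIrr_structOf (n : ℕ) (E : Config p n) :
    letI := structOf k n E
    SymmIrr k (Fin n) := by
  let _ := structOf k n E
  refine ⟨fun _ r v h => h.1, fun _ r v σ h => ⟨h.1.comp σ.injective, ?_⟩⟩
  have h1 : Finset.image (v ∘ σ) Finset.univ = Finset.image v Finset.univ := by
    rw [← Finset.image_image, Finset.image_univ_equiv]
  exact (congrArg (fun S => E r.1 S = true) h1).mpr h.2

lemma edgesOf_structOf_configOf {n : ℕ} {T : Finset (Fin p × Finset (Fin n))}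
    (hT : ∀ c ∈ T, c.2.card = k c.1) :
    letI := structOf k n (configOf T)
    edgesOf k (Fin n) = T := by
  let _ := structOf k n (configOf T)
  ext ⟨i, S⟩
  rw [mem_edgesOf]
  constructor
  · rintro ⟨v, -, hS, -, h⟩
    have h1 := of_decide_eq_true h
    convert h1
    refine hS.symm.trans ?_
    congr!
  · intro h
    have hk : S.card = k i := hT _ h
    refine ⟨fun j => S.orderEmbOfFin hk j, (S.orderEmbOfFin hk).injective, ?_,
      (S.orderEmbOfFin hk).injective, decide_eq_true ?_⟩
    · convert S.image_orderEmbOfFin_univ hk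
    · convert h
      convert S.image_orderEmbOfFin_univ hk

lemma Pev_eq_expect (n : ℕ) (Q : Config p n → Prop) :
    Pev k α γ n Q = expect (edgeProb k α γ)
      (fun T : Finset (Fin p × Finset (Fin n)) => if Q (configOf T) then 1 else 0) := by
  have hw : ∀ T : Finset (Fin p × Finset (Fin n)),
      (∏ c, if c ∈ T then edgeProb k α γ c else 1 - edgeProb k α γ c) =
        if configOf T ∈ validE k n then weight k α γ n (configOf T) else 0 := by
    intro T
    split_ifs with hT
    · simp only [validE, Finset.mem_filter, configOf, decide_eq_true_eq] at hT
      rw [weight, Fintype.prod_prod_type]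
      refine Finset.prod_congr rfl fun i _ => ?_
      rw [Finset.prod_filter]
      refine Finset.prod_congr rfl fun S _ => ?_
      by_cases hS : S.card = k i
      · simp only [edgeProb, hS, configOf, decide_eq_true_eq, if_true, Fintype.card_fin]
      · rw [if_neg hS, if_neg fun h => hS (hT.2 i S h), edgeProb, if_neg hS, sub_zero]
    · simp only [validE, Finset.mem_filter, Finset.mem_univ, true_and, configOf,
        decide_eq_true_eq] at hT
      push Not at hT
      obtain ⟨i, S, hS, hk⟩ := hT
      refine Finset.prod_eq_zero (Finset.mem_univ (i, S)) ?_
      rw [if_pos hS, edgeProb, if_neg hk]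
  rw [Pev, ← Finset.univ_inter (validE k n), ← Finset.sum_ite_mem, expect]
  refine (Fintype.sum_equiv
    (⟨configOf, fun E => Finset.univ.filter fun c => E c.1 c.2 = true, fun T => ?_, fun E => ?_⟩ :
      Finset (Fin p × Finset (Fin n)) ≃ Config p n) _ _ fun T => ?_).symm
  · ext c
    simp [configOf]
  · funext i S
    simp [configOf]
  · refine Eq.trans (b := (if configOf T ∈ validE k n then weight k α γ n (configOf T) else 0) *
      if Q (configOf T) then 1 else 0) ?_ ?_
    · congr 1
      convert hw T
    · rw [Equiv.coe_fn_mk]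
      split_ifs <;> simp

lemma expect_mono_of_ne_zero {I : Type*} [Fintype I] {pr : I → ℝ}
    (h : ∀ c, 0 ≤ pr c ∧ pr c ≤ 1) {F G : Finset I → ℝ}
    (hFG : ∀ T, (∀ c ∈ T, pr c ≠ 0) → F T ≤ G T) : expect pr F ≤ expect pr G := by
  refine Finset.sum_le_sum fun T _ => ?_
  by_cases hT : ∀ c ∈ T, pr c ≠ 0
  · refine mul_le_mul_of_nonneg_left (hFG T hT) (Finset.prod_nonneg fun c _ => ?_)
    have := h c
    split_ifs <;> linarith
  · push Not at hT
    obtain ⟨c, hc, hc0⟩ := hT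
    rw [Finset.prod_eq_zero (Finset.mem_univ c) (by rw [if_pos hc, hc0]), zero_mul, zero_mul]

lemma one_sub_expect_le_Pev {n : ℕ} (hα : ∀ i, 0 < α i) (hγ : ∀ i, 0 < γ i ∧ γ i ≤ 1)
    (hn : 0 < n) {Q : Config p n → Prop} {P : Finset (Fin p × Finset (Fin n)) → Prop}
    (hPQ : ∀ T, (∀ c ∈ T, c.2.card = k c.1) → P T → Q (configOf T)) :
    1 - expect (edgeProb k α γ) (fun T => if P T then 0 else 1) ≤ Pev k α γ n Q := by
  rw [Pev_eq_expect, sub_le_iff_le_add, ← expect_add]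
  refine (expect_one (edgeProb (V := Fin n) k α γ)).symm.trans_le
    (expect_mono_of_ne_zero (edgeProb_mem hα hγ (by simpa using hn)) fun T hT => ?_)
  have := hPQ T fun c hc => by_contra fun hck => hT c hc (if_neg hck)
  split_ifs <;> simp_all

lemma Pev_le_one {n : ℕ} (hα : ∀ i, 0 < α i) (hγ : ∀ i, 0 < γ i ∧ γ i ≤ 1) (hn : 0 < n)
    (Q : Config p n → Prop) : Pev k α γ n Q ≤ 1 := by
  rw [Pev_eq_expect]
  refine (expect_mono (edgeProb_mem hα hγ (by simpa using hn)) fun T => ?_).trans_eq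
    (expect_one (edgeProb (V := Fin n) k α γ))
  split_ifs <;> norm_num

end RandomStructure

-- STATEMENT 19
theorem semigeneric_axiom_almost_sure (k : Fin p → ℕ) (α γ : Fin p → ℝ)
    (hα : ∀ i, 0 < α i ∧ α i ≤ 1) (hγ : ∀ i, 0 < γ i ∧ γ i ≤ 1) (hirr : IrrHyp α)
    (U : Type) [Fintype U] [(Lang p k).Structure U] (hU : SymmIrr k U)
    (A B C : Finset U) (hAB : A ⊆ B) (hABne : A ≠ B) (hAC : A ⊆ C) (hBC : B ∩ C = A)
    (hKB : ∀ S : Finset U, S ⊆ B → 0 ≤ delta k α S)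
    (hKC : ∀ S : Finset U, S ⊆ C → 0 ≤ delta k α S)
    (hfree : FreelyJoined k (↑A : Set U) ↑B ↑C)
    (hsB : ∀ B₁ : Finset U, A ⊂ B₁ → B₁ ⊆ B → 0 < delta k α B₁ - delta k α A)
    (hiC : A = C ∨ ∀ C₁ : Finset U, A ⊆ C₁ → C₁ ⊂ C → delta k α C - delta k α C₁ < 0)
    (m : ℕ) (hm : C.card < m) :
    Tendsto (fun n => Pev k α γ n (fun E =>
        letI := structOf k n E;
        ∀ f : U → Fin n, IsEmbOn k C f →
          (↑(Finset.image f C) : Set (Fin n)) = cl k α m (Finset.image f A) →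
            ∃ g : U → Fin n, IsEmbOn k B g ∧ (∀ a ∈ A, g a = f a) ∧
              Finset.image g B ∩ Finset.image f C = Finset.image f A ∧
              FreelyJoined k (↑(Finset.image f A) : Set (Fin n)) ↑(Finset.image f C)
                ↑(Finset.image g B) ∧
              cl k α m (Finset.image g B) =
                ↑(Finset.image g B) ∪ (↑(Finset.image f C) : Set (Fin n))))
      atTop (𝓝 1) := by
  have hα' : ∀ i, 0 < α i := fun i => (hα i).1
  obtain ⟨η, hη, K, n₀, hK⟩ := expect_not_free_extension_le hα' hγ hU hAB hABne hAC hsB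
    (C := C) (Nat.zero_lt_of_lt hm)
  have hlim : Tendsto (fun n : ℕ => 1 - K * (n : ℝ) ^ (-η)) atTop (𝓝 1) := by
    simpa using ((tendsto_rpow_neg_atTop hη).comp tendsto_natCast_atTop_atTop).const_mul K
      |>.const_sub 1
  refine tendsto_of_tendsto_of_tendsto_of_le_of_le' hlim tendsto_const_nhds ?_ ?_
  · filter_upwards [eventually_ge_atTop n₀, eventually_gt_atTop 0] with n hn₀ hn
    have h1 := hK (V := Fin n) (by simpa using hn₀) (by simpa using hn)
    rw [Fintype.card_fin] at h1
    refine (sub_le_sub_left h1 1).trans (one_sub_expect_le_Pev hα' hγ hn fun T hT hP => ?_)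
    intro f hf hcl
    obtain ⟨g, hg, hga, hgi, hgf, hgc⟩ := hP (structOf k n (configOf T))
      (symmIrr_structOf n (configOf T)) (edgesOf_structOf_configOf hT) f hf (by convert hcl)
    refine ⟨g, hg, hga, ?_, ?_, ?_⟩
    · convert hgi
    · convert hgf
    · convert hgc
  · filter_upwards [eventually_gt_atTop 0] with n hn
    exact Pev_le_one hα' hγ hn _
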